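/- Fix $1<p,q,r<\infty$ with $\frac{1}{p}+\frac{1}{q}=\frac{1}{r}$ and $s>0$. Let $m:\mathbb{R}^2\to\mathbb{C}$ be measurable and define the four-variable symbols $\mu(\xi_1,\xi_2,\eta_1,\eta_2):=m(\xi_1,\eta_2)$ and $\nu(\xi_1,\xi_2,\eta_1,\eta_2):=m(\xi_1,\eta_2)\big(\frac{1+4\pi^2(\xi_1+\eta_1)^2}{1+4\pi^2(\eta_1^2+\eta_2^2)}\big)^{s/2}$. Then the bilinear multiplier $T_\mu$ is bounded from $\mathrm{L}^p(\mathbb{R}^2)\times\mathrm{W}^{s,q}(\mathbb{R}^2)$ to $\mathrm{L}^r_y(\mathrm{W}^{s,r}_x)$ if and only if $T_\nu$ is bounded from $\mathrm{L}^p(\mathbb{R}^2)\times\mathrm{L}^q(\mathbb{R}^2)$ to $\mathrm{L}^r(\mathbb{R}^2)$, and the corresponding operator norms are equal: $\|T_\nu\|_{\mathrm{L}^p\times\mathrm{L}^q\to\mathrm{L}^r} = \|T_\mu\|_{\mathrm{L}^p\times\mathrm{W}^{s,q}\to\mathrm{L}^r_y(\mathrm{W}^{s,r}_x)}$. -/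

import Mathlib

open MeasureTheory Filter
open scoped ENNReal NNReal Topology

noncomputable section

/-- `e2π t = exp(2πit)`. -/
def e2π (t : ℝ) : ℂ := Complex.exp (2 * (Real.pi : ℂ) * Complex.I * (t : ℂ))

/-- Two-dimensional Fourier transform `f̂(ζ) = ∫ f(u) e^{-2πi u·ζ} du`. -/
def FT2 (f : ℝ × ℝ → ℂ) (ζ : ℝ × ℝ) : ℂ :=
  ∫ u : ℝ × ℝ, f u * e2π (-(u.1 * ζ.1 + u.2 * ζ.2))

/-- One-dimensional Fourier transform. -/
def FT1 (φ : ℝ → ℂ) (ξ : ℝ) : ℂ := ∫ t : ℝ, φ t * e2π (-(t * ξ))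

/-- The bilinear Fourier multiplier with symbol `μ` on `ℝ⁴`. -/
def Tmu (μ : (ℝ × ℝ) × (ℝ × ℝ) → ℂ) (f g : ℝ × ℝ → ℂ) (z : ℝ × ℝ) : ℂ :=
  ∫ w : (ℝ × ℝ) × (ℝ × ℝ),
    μ w * e2π (z.1 * (w.1.1 + w.2.1) + z.2 * (w.1.2 + w.2.2)) * FT2 f w.1 * FT2 g w.2

/-- The bilinear operator with `(x,y)`-dependent symbol `σ(x,y,ξ₁,η₂)`. -/
def Tsigma (σ : (ℝ × ℝ) → (ℝ × ℝ) → ℂ) (f g : ℝ × ℝ → ℂ) (z : ℝ × ℝ) : ℂ :=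
  ∫ w : (ℝ × ℝ) × (ℝ × ℝ),
    σ z (w.1.1, w.2.2) * e2π (z.1 * (w.1.1 + w.2.1) + z.2 * (w.1.2 + w.2.2)) *
      FT2 f w.1 * FT2 g w.2

/-- The `L^p(ℝ²)` norm. -/
def LpNorm (p : ℝ) (f : ℝ × ℝ → ℂ) : ℝ≥0∞ := eLpNorm f (ENNReal.ofReal p) volume

/-- `(I - Δ)^{s/2} f`, the Fourier multiplier with symbol `(1+4π²|ζ|²)^{s/2}`. -/
def JsFull (s : ℝ) (f : ℝ × ℝ → ℂ) (x : ℝ × ℝ) : ℂ :=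
  ∫ ζ : ℝ × ℝ,
    (((1 + 4 * Real.pi ^ 2 * (ζ.1 ^ 2 + ζ.2 ^ 2)) ^ (s / 2) : ℝ) : ℂ) * FT2 f ζ *
      e2π (x.1 * ζ.1 + x.2 * ζ.2)

/-- `(I - Δ_x)^{s/2} f`, the Fourier multiplier with symbol `(1+4π²ζ₁²)^{s/2}`. -/
def JsX (s : ℝ) (f : ℝ × ℝ → ℂ) (x : ℝ × ℝ) : ℂ :=
  ∫ ζ : ℝ × ℝ,
    (((1 + 4 * Real.pi ^ 2 * ζ.1 ^ 2) ^ (s / 2) : ℝ) : ℂ) * FT2 f ζ *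
      e2π (x.1 * ζ.1 + x.2 * ζ.2)

/-- The non-homogeneous Sobolev norm `‖f‖_{W^{s,p}}`. -/
def WNorm (s p : ℝ) (f : ℝ × ℝ → ℂ) : ℝ≥0∞ := eLpNorm (JsFull s f) (ENNReal.ofReal p) volume

/-- The mixed Sobolev norm `‖f‖_{L^p_y(W^{s,p}_x)}`. -/
def WxNorm (s r : ℝ) (f : ℝ × ℝ → ℂ) : ℝ≥0∞ := eLpNorm (JsX s f) (ENNReal.ofReal r) volume

/-- `L¹`-normalized dilate `φ_k(t) = 2^k φ(2^k t)`. -/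
def dil (φ : ℝ → ℂ) (k : ℤ) (t : ℝ) : ℂ := (((2 : ℝ) ^ k : ℝ) : ℂ) * φ ((2 : ℝ) ^ k * t)

/-- Fiber-wise convolution in the first variable. -/
def Px (φ : ℝ → ℂ) (f : ℝ × ℝ → ℂ) (z : ℝ × ℝ) : ℂ := ∫ t : ℝ, f (z.1 - t, z.2) * φ t

/-- Fiber-wise convolution in the second variable. -/
def Py (ψ : ℝ → ℂ) (g : ℝ × ℝ → ℂ) (z : ℝ × ℝ) : ℂ := ∫ t : ℝ, g (z.1, z.2 - t) * ψ t

/-- The twisted paraproduct with coefficients `λ = (λ_k)_{k ∈ ℤ}`. -/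
def TwPara (φ ψ : ℝ → ℂ) (lam : ℤ → ℂ) (f g : ℝ × ℝ → ℂ) (z : ℝ × ℝ) : ℂ :=
  ∑' k : ℤ, lam k * Px (dil φ k) f z * Py (dil ψ k) g z

/-- The Schwartz seminorm `‖φ‖_{α,β} = sup_t |t|^α |∂^β φ(t)|`. -/
def schSemi (φ : ℝ → ℂ) (α β : ℕ) : ℝ := ⨆ t : ℝ, |t| ^ α * ‖iteratedDeriv β φ t‖

/-- `max_{0 ≤ α,β ≤ 3} ‖φ‖_{α,β}`. -/
def maxSchSemi3 (φ : ℝ → ℂ) : ℝ := ⨆ ab : Fin 4 × Fin 4, schSemi φ (ab.1 : ℕ) (ab.2 : ℕ)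

/-- The mixed partial derivative `∂_{τ₁}^{β₁} ∂_{τ₂}^{β₂} F`. -/
def pd (β₁ β₂ : ℕ) (F : ℝ → ℝ → ℂ) (τ₁ τ₂ : ℝ) : ℂ :=
  iteratedDeriv β₁ (fun a => iteratedDeriv β₂ (F a) τ₂) τ₁

/-- The mixed partial derivative `∂_x^{α₁} ∂_y^{α₂} ∂_{τ₁}^{β₁} ∂_{τ₂}^{β₂} F`. -/
def pd4 (α₁ α₂ β₁ β₂ : ℕ) (F : ℝ → ℝ → ℝ → ℝ → ℂ) (x y τ₁ τ₂ : ℝ) : ℂ :=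
  iteratedDeriv α₁ (fun a =>
    iteratedDeriv α₂ (fun b =>
      iteratedDeriv β₁ (fun u => iteratedDeriv β₂ (fun v => F a b u v) τ₂) τ₁) y) x

/-- `∂_x^n F` for `F : ℝ² → ℂ` (derivative in the first variable). -/
def pdx (n : ℕ) (F : ℝ × ℝ → ℂ) (z : ℝ × ℝ) : ℂ := iteratedDeriv n (fun t => F (t, z.2)) z.1

/-- `∂_y^n F` for `F : ℝ² → ℂ` (derivative in the second variable). -/
def pdy (n : ℕ) (F : ℝ × ℝ → ℂ) (z : ℝ × ℝ) : ℂ := iteratedDeriv n (fun t => F (z.1, t)) z.2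

/-- `ϑ(τ) = θ(τ/2) - θ(τ)`. -/
def vartheta (θ : ℝ → ℝ) (τ : ℝ) : ℝ := θ (τ / 2) - θ τ

/-- The modulated dilate `f_ε(x,y) = e^{2πi(ξ⁰₁x + ξ⁰₂y)} Φ(εx, εy)`. -/
def fEps (ξ0 : ℝ × ℝ) (Φ : ℝ × ℝ → ℂ) (ε : ℝ) (z : ℝ × ℝ) : ℂ :=
  e2π (ξ0.1 * z.1 + ξ0.2 * z.2) * Φ (ε * z.1, ε * z.2)

/-- `h_ε(x,y) = ε² e^{2πi(ζ⁰₁x + ζ⁰₂y)} Ψ(εx, εy)`. -/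
def hEps (ζ0 : ℝ × ℝ) (Ψ : ℝ × ℝ → ℂ) (ε : ℝ) (z : ℝ × ℝ) : ℂ :=
  ((ε ^ 2 : ℝ) : ℂ) * e2π (ζ0.1 * z.1 + ζ0.2 * z.2) * Ψ (ε * z.1, ε * z.2)

/-- The symbol `μ(ξ₁,ξ₂,η₁,η₂) = m(ξ₁,η₂)`. -/
def muSymb (m : ℝ × ℝ → ℂ) (w : (ℝ × ℝ) × (ℝ × ℝ)) : ℂ := m (w.1.1, w.2.2)

/-- The modified symbol
`ν(ξ₁,ξ₂,η₁,η₂) = m(ξ₁,η₂) ((1+4π²(ξ₁+η₁)²)/(1+4π²(η₁²+η₂²)))^{s/2}`. -/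
def nuSymb (m : ℝ × ℝ → ℂ) (s : ℝ) (w : (ℝ × ℝ) × (ℝ × ℝ)) : ℂ :=
  m (w.1.1, w.2.2) *
    ((((1 + 4 * Real.pi ^ 2 * (w.1.1 + w.2.1) ^ 2) /
        (1 + 4 * Real.pi ^ 2 * (w.2.1 ^ 2 + w.2.2 ^ 2))) ^ (s / 2) : ℝ) : ℂ)

/-- The set of admissible constants for the `L^p × L^q → L^r` bound for `T_ν`. -/
def nuConsts (m : ℝ × ℝ → ℂ) (s p q r : ℝ) : Set ℝ :=
  {C : ℝ | 0 ≤ C ∧ ∀ f g : SchwartzMap (ℝ × ℝ) ℂ,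
    LpNorm r (Tmu (nuSymb m s) ⇑f ⇑g) ≤ ENNReal.ofReal C * LpNorm p ⇑f * LpNorm q ⇑g}

/-- The set of admissible constants for the `L^p × W^{s,q} → L^r_y(W^{s,r}_x)` bound for `T_μ`. -/
def muConsts (m : ℝ × ℝ → ℂ) (s p q r : ℝ) : Set ℝ :=
  {C : ℝ | 0 ≤ C ∧ ∀ f g : SchwartzMap (ℝ × ℝ) ℂ,
    WxNorm s r (Tmu (muSymb m) ⇑f ⇑g) ≤ ENNReal.ofReal C * LpNorm p ⇑f * WNorm s q ⇑g}

open FourierTransform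

lemma e2π_eq (t : ℝ) : e2π t = Real.fourierChar t := by
  rw [Real.fourierChar_apply, e2π]
  congr 1
  push_cast
  ring

@[simp] lemma norm_e2π (t : ℝ) : ‖e2π t‖ = 1 := by
  rw [e2π_eq, Circle.norm_coe]

lemma e2π_add (a b : ℝ) : e2π (a + b) = e2π a * e2π b := by
  simp only [e2π, ← Complex.exp_add]
  congr 1
  push_cast
  ring

@[simp] lemma e2π_zero : e2π 0 = 1 := by simp [e2π]

@[fun_prop] lemma continuous_e2π : Continuous e2π := by
  unfold e2π
  fun_prop

/-- The Euclidean plane, as opposed to `ℝ × ℝ` with the supremum norm. -/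
abbrev EPlane := WithLp 2 (ℝ × ℝ)

/-- The identity map from the plane with the supremum norm to the Euclidean plane. -/
def toE : (ℝ × ℝ) ≃L[ℝ] EPlane := (WithLp.prodContinuousLinearEquiv 2 ℝ ℝ ℝ).symm

lemma integral_toE (F : EPlane → ℂ) : ∫ v, F v = ∫ u : ℝ × ℝ, F (toE u) :=
  ((WithLp.volume_preserving_toLp (U := ℝ) (V := ℝ)).integral_comp
    (MeasurableEquiv.toLp 2 (ℝ × ℝ)).measurableEmbedding F).symm

lemma inner_toE (u ζ : ℝ × ℝ) : inner ℝ (toE u) (toE ζ) = u.1 * ζ.1 + u.2 * ζ.2 := by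
  simp [toE, WithLp.prod_inner_apply, mul_comm]

lemma norm_toE_sq (ζ : ℝ × ℝ) : ‖toE ζ‖ ^ 2 = ζ.1 ^ 2 + ζ.2 ^ 2 := by
  rw [← real_inner_self_eq_norm_sq, inner_toE]
  ring

/-- Schwartz functions on the plane. -/
abbrev Sch := SchwartzMap (ℝ × ℝ) ℂ

/-- The Fourier transform as a map on Schwartz functions. -/
def schFT (f : Sch) : Sch :=
  SchwartzMap.compCLMOfContinuousLinearEquiv ℂ toE
    (𝓕 (SchwartzMap.compCLMOfContinuousLinearEquiv ℂ toE.symm f))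

/-- The inverse Fourier transform as a map on Schwartz functions. -/
def schIFT (f : Sch) : Sch :=
  SchwartzMap.compCLMOfContinuousLinearEquiv ℂ toE
    (𝓕⁻ (SchwartzMap.compCLMOfContinuousLinearEquiv ℂ toE.symm f))

lemma compCLM_toE_symm_toE (f : SchwartzMap EPlane ℂ) :
    SchwartzMap.compCLMOfContinuousLinearEquiv ℂ toE.symm
      (SchwartzMap.compCLMOfContinuousLinearEquiv ℂ toE f) = f := by
  ext x
  simp

lemma compCLM_toE_toE_symm (f : Sch) :
    SchwartzMap.compCLMOfContinuousLinearEquiv ℂ toE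
      (SchwartzMap.compCLMOfContinuousLinearEquiv ℂ toE.symm f) = f := by
  ext x
  simp

lemma schFT_schIFT (f : Sch) : schFT (schIFT f) = f := by
  rw [schFT, schIFT, compCLM_toE_symm_toE, FourierTransform.fourier_fourierInv_eq,
    compCLM_toE_toE_symm]

lemma schIFT_schFT (f : Sch) : schIFT (schFT f) = f := by
  rw [schFT, schIFT, compCLM_toE_symm_toE, FourierTransform.fourierInv_fourier_eq,
    compCLM_toE_toE_symm]

lemma schFT_apply (f : Sch) (ζ : ℝ × ℝ) : schFT f ζ = FT2 f ζ := by
  rw [schFT, SchwartzMap.compCLMOfContinuousLinearEquiv_apply, Function.comp_apply,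
    SchwartzMap.fourier_coe, Real.fourier_eq, integral_toE, FT2]
  congr 1 with u
  rw [inner_toE, e2π_eq, SchwartzMap.compCLMOfContinuousLinearEquiv_apply, Function.comp_apply,
    toE.symm_apply_apply, Circle.smul_def, smul_eq_mul, mul_comm]

lemma schIFT_apply (f : Sch) (x : ℝ × ℝ) :
    schIFT f x = ∫ ζ : ℝ × ℝ, f ζ * e2π (x.1 * ζ.1 + x.2 * ζ.2) := by
  rw [schIFT, SchwartzMap.compCLMOfContinuousLinearEquiv_apply, Function.comp_apply,
    SchwartzMap.fourierInv_coe, Real.fourierInv_eq, integral_toE]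
  congr 1 with u
  rw [inner_toE, e2π_eq, SchwartzMap.compCLMOfContinuousLinearEquiv_apply, Function.comp_apply,
    toE.symm_apply_apply, Circle.smul_def, smul_eq_mul, mul_comm]
  ring_nf

lemma FT2_schIFT (f : Sch) (ζ : ℝ × ℝ) : FT2 (schIFT f) ζ = f ζ := by
  rw [← schFT_apply, schFT_schIFT]

lemma FT2_eq_schFT (f : Sch) : FT2 f = schFT f := by
  ext ζ
  rw [schFT_apply]

/-- The symbol `(1 + 4π²|ζ|²)^{s/2}` of `(I - Δ)^{s/2}`. -/
def besselWeight (s : ℝ) (ζ : ℝ × ℝ) : ℝ :=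
  (1 + 4 * Real.pi ^ 2 * (ζ.1 ^ 2 + ζ.2 ^ 2)) ^ (s / 2)

lemma besselWeight_pos (s : ℝ) (ζ : ℝ × ℝ) : 0 < besselWeight s ζ := by
  unfold besselWeight
  positivity

lemma besselWeight_hasTemperateGrowth (s : ℝ) :
    (fun ζ => ((besselWeight s ζ : ℝ) : ℂ)).HasTemperateGrowth := by
  have h : (fun ζ => ((besselWeight s ζ : ℝ) : ℂ)) =
      Complex.ofReal ∘ ((fun v : EPlane => (1 + ‖v‖ ^ 2) ^ (s / 2)) ∘
        ((2 * Real.pi) • toE.toContinuousLinearMap)) := by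
    ext ζ
    simp only [besselWeight, Function.comp_apply, smul_apply, norm_smul,
      mul_pow, ContinuousLinearEquiv.coe_coe, norm_toE_sq, Real.norm_eq_abs, sq_abs]
    norm_num
  rw [h]
  exact Function.Complex.hasTemperateGrowth_ofReal.comp
    ((Function.hasTemperateGrowth_one_add_norm_sq_rpow EPlane (s / 2)).comp
      (ContinuousLinearMap.hasTemperateGrowth _))

/-- The Bessel potential `(I - Δ)^{s/2}` as a map on Schwartz functions. -/
def bessel (s : ℝ) (f : Sch) : Sch :=
  schIFT (SchwartzMap.smulLeftCLM ℂ (fun ζ => ((besselWeight s ζ : ℝ) : ℂ)) (schFT f))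

lemma FT2_bessel (s : ℝ) (f : Sch) (ζ : ℝ × ℝ) :
    FT2 (bessel s f) ζ = (besselWeight s ζ : ℂ) * FT2 f ζ := by
  rw [bessel, FT2_schIFT, SchwartzMap.smulLeftCLM_apply_apply (besselWeight_hasTemperateGrowth s),
    schFT_apply, smul_eq_mul]

lemma bessel_bessel_neg (s : ℝ) (f : Sch) : bessel s (bessel (-s) f) = f := by
  rw [← schIFT_schFT (bessel s (bessel (-s) f)), ← schIFT_schFT f]
  congr 1
  ext ζ
  rw [schFT_apply, FT2_bessel, FT2_bessel, schIFT_schFT, schFT_apply, ← mul_assoc,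
    ← Complex.ofReal_mul, besselWeight, besselWeight, neg_div, Real.rpow_neg (by positivity),
    mul_inv_cancel₀ (by positivity), Complex.ofReal_one, one_mul]

lemma JsFull_eq_bessel (s : ℝ) (f : Sch) : JsFull s f = bessel s f := by
  ext x
  rw [bessel, schIFT_apply, JsFull]
  congr 1 with ζ
  rw [SchwartzMap.smulLeftCLM_apply_apply (besselWeight_hasTemperateGrowth s), schFT_apply,
    smul_eq_mul, besselWeight]

lemma WNorm_eq (s q : ℝ) (f : Sch) : WNorm s q f = LpNorm q (bessel s f) := by
  rw [WNorm, LpNorm, JsFull_eq_bessel]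

/-- The involution of `ℝ⁴` exchanging the second and the fourth coordinate. -/
def exch : ((ℝ × ℝ) × (ℝ × ℝ)) ≃ᵐ ((ℝ × ℝ) × (ℝ × ℝ)) where
  toFun w := ((w.1.1, w.2.2), (w.2.1, w.1.2))
  invFun w := ((w.1.1, w.2.2), (w.2.1, w.1.2))
  left_inv _ := rfl
  right_inv _ := rfl
  measurable_toFun := by
    simp only [Equiv.coe_fn_mk]
    fun_prop
  measurable_invFun := by
    simp only [Equiv.coe_fn_symm_mk]
    fun_prop

lemma exch_apply (w : (ℝ × ℝ) × (ℝ × ℝ)) : exch w = ((w.1.1, w.2.2), (w.2.1, w.1.2)) := rfl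

lemma measurePreserving_prodAssoc {α β γ : Type*} [MeasureSpace α] [MeasureSpace β]
    [MeasureSpace γ] [SFinite (volume : Measure α)] [SFinite (volume : Measure β)]
    [SFinite (volume : Measure γ)] :
    MeasurePreserving (MeasurableEquiv.prodAssoc : (α × β) × γ ≃ᵐ α × β × γ) :=
  ⟨MeasurableEquiv.measurable _, Measure.prodAssoc_prod⟩

lemma measurePreserving_exch : MeasurePreserving exch := by
  have hA : MeasurePreserving (MeasurableEquiv.prodAssoc : (ℝ × ℝ) × (ℝ × ℝ) ≃ᵐ _) :=
    measurePreserving_prodAssoc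
  have hB : MeasurePreserving (MeasurableEquiv.prodAssoc : (ℝ × ℝ) × ℝ ≃ᵐ _) :=
    measurePreserving_prodAssoc
  have hid := MeasurePreserving.id (volume : Measure ℝ)
  have hS : MeasurePreserving (Prod.swap : ℝ × (ℝ × ℝ) → _) := Measure.measurePreserving_swap
  have hT : MeasurePreserving (Prod.swap : ℝ × ℝ → _) := Measure.measurePreserving_swap
  have hρ : MeasurePreserving (fun t : ℝ × (ℝ × ℝ) => (t.2.2, t.2.1, t.1)) :=
    hB.comp ((hT.prod hid).comp hS)
  exact (hA.symm _).comp ((hid.prod hρ).comp hA)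

lemma integral_exch (F : (ℝ × ℝ) × (ℝ × ℝ) → ℂ) : ∫ w, F (exch w) = ∫ w, F w :=
  measurePreserving_exch.integral_comp exch.measurableEmbedding F

/-- The integrable function `(1 + t²)⁻¹` that controls the decay of Schwartz functions. -/
def dec (t : ℝ) : ℝ := (1 + t ^ 2)⁻¹

lemma dec_pos (t : ℝ) : 0 < dec t := by
  unfold dec
  positivity

@[fun_prop] lemma continuous_dec : Continuous dec := by
  unfold dec
  exact Continuous.inv₀ (by fun_prop) fun t => by positivity

lemma integrable_dec : Integrable dec := integrable_inv_one_add_sq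

lemma integrable_dec_prod : Integrable fun z : ℝ × ℝ => dec z.1 * dec z.2 :=
  integrable_dec.mul_prod integrable_dec

lemma SchwartzMap.exists_norm_le_dec (h : Sch) :
    ∃ K, 0 ≤ K ∧ ∀ z, ‖h z‖ ≤ K * (dec z.1 * dec z.2) := by
  have hK (z : ℝ × ℝ) : (1 + ‖z‖) ^ 4 * ‖h z‖ ≤ 2 ^ 4 *
      ((Finset.Iic ((4, 0) : ℕ × ℕ)).sup fun i => SchwartzMap.seminorm ℂ i.1 i.2) h := by
    simpa using SchwartzMap.one_add_le_sup_seminorm_apply (𝕜 := ℂ) (m := (4, 0)) (k := 4) (n := 0)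
      le_rfl le_rfl h z
  refine ⟨_, le_trans (by positivity) (hK 0), fun z => ?_⟩
  have h1 : |z.1| ≤ ‖z‖ := norm_fst_le z
  have h2 : |z.2| ≤ ‖z‖ := norm_snd_le z
  have h3 : 1 + z.1 ^ 2 ≤ (1 + ‖z‖) ^ 2 := by
    rw [← sq_abs z.1]
    nlinarith [abs_nonneg z.1, norm_nonneg z]
  have h4 : 1 + z.2 ^ 2 ≤ (1 + ‖z‖) ^ 2 := by
    rw [← sq_abs z.2]
    nlinarith [abs_nonneg z.2, norm_nonneg z]
  have h5 : (1 + z.1 ^ 2) * (1 + z.2 ^ 2) ≤ (1 + ‖z‖) ^ 4 := by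
    calc _ ≤ (1 + ‖z‖) ^ 2 * (1 + ‖z‖) ^ 2 := by gcongr
      _ = _ := by ring
  rw [dec, dec, ← mul_inv, ← div_eq_mul_inv, le_div_iff₀ (by positivity), mul_comm]
  exact le_trans (by gcongr) (hK z)

/-- The Fourier transform of `f` in the first variable only. -/
def partialFT (f : ℝ × ℝ → ℂ) (ξ y : ℝ) : ℂ := ∫ u : ℝ, f (u, y) * e2π (-(u * ξ))

lemma norm_mul_e2π (c : ℂ) (t : ℝ) : ‖c * e2π t‖ = ‖c‖ := by simp

lemma continuous_partialFT (f : Sch) : Continuous fun z : ℝ × ℝ => partialFT f z.1 z.2 := by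
  obtain ⟨K, hK, h⟩ := f.exists_norm_le_dec
  refine continuous_of_dominated (bound := fun u => K * dec u) ?_ ?_
    (integrable_dec.const_mul K) ?_
  · intro z
    have : Continuous fun u : ℝ => f (u, z.2) * e2π (-(u * z.1)) := by fun_prop
    exact this.aestronglyMeasurable
  · refine fun z => .of_forall fun u => ?_
    rw [norm_mul_e2π]
    refine (h _).trans ?_
    have : dec z.2 ≤ 1 := inv_le_one_of_one_le₀ (by nlinarith)
    have := dec_pos u
    gcongr
    nlinarith
  · exact .of_forall fun u => by fun_prop

lemma integrable_mul_e2π {α : Type*} [MeasureSpace α] {F : α → ℂ} (hF : Integrable F) {φ : α → ℝ}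
    (hφ : Measurable φ) : Integrable fun x => F x * e2π (φ x) := by
  refine hF.norm.mono' (hF.1.mul ?_) (.of_forall fun x => by simp)
  exact (continuous_e2π.measurable.comp hφ).aestronglyMeasurable

lemma FT2_eq_integral_partialFT (f : Sch) (ζ : ℝ × ℝ) :
    FT2 f ζ = ∫ y : ℝ, partialFT f ζ.1 y * e2π (-(y * ζ.2)) := by
  rw [FT2, Measure.volume_eq_prod, integral_prod_symm]
  · congr 1 with y
    rw [partialFT, ← integral_mul_const]
    congr 1 with u
    rw [mul_assoc, ← e2π_add]
    ring_nf
  · exact integrable_mul_e2π f.integrable (by fun_prop)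

lemma integrable_partialFT (f : Sch) (ξ : ℝ) : Integrable fun y : ℝ => partialFT f ξ y := by
  have := (integrable_mul_e2π f.integrable (φ := fun u : ℝ × ℝ => -(u.1 * ξ)) (by fun_prop))
  exact this.integral_prod_right

lemma exists_norm_FT2_le (f : Sch) :
    ∃ K, 0 ≤ K ∧ ∀ ζ, ‖FT2 f ζ‖ ≤ K * (dec ζ.1 * dec ζ.2) := by
  rw [FT2_eq_schFT]
  exact (schFT f).exists_norm_le_dec

@[fun_prop] lemma continuous_FT2 (f : Sch) : Continuous (FT2 f) := by
  rw [FT2_eq_schFT]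
  exact (schFT f).continuous

lemma integrable_FT2_slice (f : Sch) (ξ : ℝ) : Integrable fun ξ₂ : ℝ => FT2 f (ξ, ξ₂) := by
  obtain ⟨K, hK, h⟩ := exists_norm_FT2_le f
  refine ((integrable_dec.const_mul (dec ξ)).const_mul K).mono'
    (by fun_prop) (.of_forall fun u => h (ξ, u))

/-- Fourier inversion in the second variable. -/
lemma integral_FT2_slice (f : Sch) (ξ y : ℝ) :
    ∫ ξ₂ : ℝ, FT2 f (ξ, ξ₂) * e2π (y * ξ₂) = partialFT f ξ y := by
  have hF : 𝓕 (fun y => partialFT f ξ y) = fun ξ₂ => FT2 f (ξ, ξ₂) := by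
    ext ξ₂
    rw [Real.fourier_real_eq, FT2_eq_integral_partialFT]
    congr 1 with y
    rw [e2π_eq, Circle.smul_def, smul_eq_mul, mul_comm]
  have hc : Continuous fun y => partialFT f ξ y :=
    (continuous_partialFT f).comp (by fun_prop : Continuous fun y : ℝ => (ξ, y))
  have := hc.fourierInv_fourier_eq (integrable_partialFT f ξ)
    (by rw [hF]; exact integrable_FT2_slice f ξ)
  rw [hF] at this
  rw [← congrFun this y, Real.fourierInv_eq']
  congr 1 with ξ₂
  rw [e2π, smul_eq_mul, mul_comm]
  congr 2
  simp
  ring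

lemma exists_norm_partialFT_le (f : Sch) :
    ∃ K, 0 ≤ K ∧ ∀ ξ y, ‖partialFT f ξ y‖ ≤ K * (dec ξ * dec y) := by
  have hg : (fun z : ℝ × ℝ => ((1 + z.2 ^ 2 : ℝ) : ℂ)).HasTemperateGrowth := by
    have : (fun z : ℝ × ℝ => ((1 + z.2 ^ 2 : ℝ) : ℂ)) = fun z : ℝ × ℝ =>
      1 + ((Complex.ofRealCLM ∘L ContinuousLinearMap.snd ℝ ℝ ℝ) z) ^ 2 := by
      ext z
      simp
    rw [this]
    exact (Function.HasTemperateGrowth.const _).add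
      ((ContinuousLinearMap.hasTemperateGrowth _).pow 2)
  set k : Sch := SchwartzMap.smulLeftCLM ℂ (fun z : ℝ × ℝ => ((1 + z.2 ^ 2 : ℝ) : ℂ)) f with hk
  have hkf (ξ y : ℝ) : partialFT k ξ y = ((1 + y ^ 2 : ℝ) : ℂ) * partialFT f ξ y := by
    rw [partialFT, partialFT, ← integral_const_mul]
    congr 1 with u
    rw [hk, SchwartzMap.smulLeftCLM_apply_apply hg, smul_eq_mul, mul_assoc]
  obtain ⟨K, hK, h⟩ := exists_norm_FT2_le k
  refine ⟨K * ∫ t, dec t, mul_nonneg hK (integral_nonneg fun t => (dec_pos t).le), fun ξ y => ?_⟩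
  have h1 : ‖partialFT k ξ y‖ ≤ K * (dec ξ * ∫ t, dec t) := by
    rw [← integral_FT2_slice, ← integral_const_mul, ← integral_const_mul]
    refine norm_integral_le_of_norm_le ((integrable_dec.const_mul _).const_mul _)
      (.of_forall fun t => ?_)
    rw [norm_mul_e2π]
    exact h (ξ, t)
  rw [hkf, norm_mul, Complex.norm_real, Real.norm_of_nonneg (by positivity)] at h1
  rw [dec.eq_1 y, ← mul_assoc, ← div_eq_mul_inv, le_div_iff₀ (by positivity)]
  linarith

/-- The reflection `g(y, x)` of a Schwartz function. -/
def swapSch (g : Sch) : Sch :=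
  SchwartzMap.compCLMOfContinuousLinearEquiv ℂ (ContinuousLinearEquiv.prodComm ℝ ℝ ℝ) g

lemma FT2_swapSch (g : Sch) (a b : ℝ) : FT2 (swapSch g) (a, b) = FT2 g (b, a) := by
  rw [FT2, FT2]
  refine Eq.trans ?_ ((Measure.measurePreserving_swap (μ := volume) (ν := volume)).integral_comp
    MeasurableEquiv.prodComm.measurableEmbedding _)
  congr 1 with u
  simp only [swapSch, SchwartzMap.compCLMOfContinuousLinearEquiv_apply, Function.comp_apply,
    ContinuousLinearEquiv.prodComm_apply, Prod.fst_swap, Prod.snd_swap]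
  rw [add_comm]

lemma integrable_symbol_mul {m : ℝ × ℝ → ℂ} (hmeas : Measurable m)
    (hm : Integrable fun z => ‖m z‖ * (dec z.1 * dec z.2)) {F : (ℝ × ℝ) × (ℝ × ℝ) → ℂ}
    (hF : AEStronglyMeasurable F) {K : ℝ}
    (hK : ∀ v, ‖F v‖ ≤ K * ((dec v.1.1 * dec v.1.2) * (dec v.2.1 * dec v.2.2))) :
    Integrable fun v : (ℝ × ℝ) × (ℝ × ℝ) => m v.1 * F v := by
  refine ((hm.mul_prod integrable_dec_prod).const_mul K).mono'
    ((hmeas.comp measurable_fst).aestronglyMeasurable.mul hF) (.of_forall fun v => ?_)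
  rw [norm_mul]
  calc _ ≤ ‖m v.1‖ * (K * ((dec v.1.1 * dec v.1.2) * (dec v.2.1 * dec v.2.2))) := by
        gcongr
        exact hK v
    _ = _ := by ring

lemma exists_norm_FT2_mul_FT2_le (f g : Sch) :
    ∃ K, ∀ v : (ℝ × ℝ) × (ℝ × ℝ), ‖FT2 f (v.1.1, v.2.2) * FT2 g (v.2.1, v.1.2)‖ ≤
      K * ((dec v.1.1 * dec v.1.2) * (dec v.2.1 * dec v.2.2)) := by
  obtain ⟨K, hK, hf⟩ := exists_norm_FT2_le f
  obtain ⟨L, hL, hg⟩ := exists_norm_FT2_le g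
  refine ⟨K * L, fun v => ?_⟩
  rw [norm_mul]
  have := dec_pos v.1.1
  have := dec_pos v.2.2
  calc _ ≤ (K * (dec v.1.1 * dec v.2.2)) * (L * (dec v.2.1 * dec v.1.2)) := by
        gcongr
        exacts [hf _, hg _]
    _ = _ := by ring

lemma Tmu_muSymb_eq {m : ℝ × ℝ → ℂ} (hmeas : Measurable m)
    (hm : Integrable fun z => ‖m z‖ * (dec z.1 * dec z.2)) (f g : Sch) (z : ℝ × ℝ) :
    Tmu (muSymb m) f g z = ∫ c : ℝ × ℝ, m c * (e2π (z.1 * c.1 + z.2 * c.2) *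
      (partialFT f c.1 z.2 * partialFT (swapSch g) c.2 z.1)) := by
  obtain ⟨K, hK⟩ := exists_norm_FT2_mul_FT2_le f g
  have hint := integrable_symbol_mul hmeas hm (K := K)
    (F := fun v => e2π (z.1 * (v.1.1 + v.2.1) + z.2 * (v.2.2 + v.1.2)) *
      (FT2 f (v.1.1, v.2.2) * FT2 g (v.2.1, v.1.2)))
    (by fun_prop) (fun v => by rw [norm_mul, norm_e2π, one_mul]; exact hK v)
  have h1 : Tmu (muSymb m) f g z = ∫ v : (ℝ × ℝ) × (ℝ × ℝ), m v.1 *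
      (e2π (z.1 * (v.1.1 + v.2.1) + z.2 * (v.2.2 + v.1.2)) *
      (FT2 f (v.1.1, v.2.2) * FT2 g (v.2.1, v.1.2))) := by
    rw [← integral_exch, Tmu]
    congr 1 with w
    simp only [exch_apply, muSymb]
    ring
  rw [h1, Measure.volume_eq_prod, integral_prod _ hint]
  congr 1 with c
  dsimp only
  rw [integral_const_mul]
  congr 1
  rw [← integral_FT2_slice, ← integral_FT2_slice, mul_comm (∫ ξ₂ : ℝ, _), ← integral_prod_mul,
    ← integral_const_mul]
  congr 1 with d
  rw [FT2_swapSch, show z.1 * (c.1 + d.1) + z.2 * (d.2 + c.2) =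
    (z.1 * c.1 + z.2 * c.2) + (z.1 * d.1 + z.2 * d.2) by ring, e2π_add, e2π_add (z.1 * d.1)]
  ring

lemma FT2_Tmu_muSymb {m : ℝ × ℝ → ℂ} (hmeas : Measurable m)
    (hm : Integrable fun z => ‖m z‖ * (dec z.1 * dec z.2)) (f g : Sch) (ζ : ℝ × ℝ) :
    FT2 (Tmu (muSymb m) f g) ζ =
      ∫ c : ℝ × ℝ, m c * (FT2 f (c.1, ζ.2 - c.2) * FT2 g (ζ.1 - c.1, c.2)) := by
  obtain ⟨K, hK, hf⟩ := exists_norm_partialFT_le f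
  obtain ⟨L, hL, hg⟩ := exists_norm_partialFT_le (swapSch g)
  have hcf : Continuous fun v : (ℝ × ℝ) × (ℝ × ℝ) => partialFT f v.1.1 v.2.2 :=
    (continuous_partialFT f).comp
      (by fun_prop : Continuous fun v : (ℝ × ℝ) × (ℝ × ℝ) => (v.1.1, v.2.2))
  have hcg : Continuous fun v : (ℝ × ℝ) × (ℝ × ℝ) => partialFT (swapSch g) v.1.2 v.2.1 :=
    (continuous_partialFT (swapSch g)).comp
      (by fun_prop : Continuous fun v : (ℝ × ℝ) × (ℝ × ℝ) => (v.1.2, v.2.1))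
  have hint := integrable_symbol_mul hmeas hm (K := K * L)
    (F := fun v => e2π (v.2.1 * v.1.1 + v.2.2 * v.1.2) *
      (partialFT f v.1.1 v.2.2 * partialFT (swapSch g) v.1.2 v.2.1) *
      e2π (-(v.2.1 * ζ.1 + v.2.2 * ζ.2)))
    (by fun_prop) (fun v => by
      rw [norm_mul, norm_mul, norm_mul, norm_e2π, norm_e2π, one_mul, mul_one]
      have := dec_pos v.1.1
      have := dec_pos v.2.2
      calc _ ≤ (K * (dec v.1.1 * dec v.2.2)) * (L * (dec v.1.2 * dec v.2.1)) := by
            gcongr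
            exacts [hf _ _, hg _ _]
        _ = _ := by ring)
  have h1 : FT2 (Tmu (muSymb m) f g) ζ = ∫ u : ℝ × ℝ, ∫ c : ℝ × ℝ, m c *
      (e2π (u.1 * c.1 + u.2 * c.2) *
      (partialFT f c.1 u.2 * partialFT (swapSch g) c.2 u.1) * e2π (-(u.1 * ζ.1 + u.2 * ζ.2))) := by
    rw [FT2]
    congr 1 with u
    rw [Tmu_muSymb_eq hmeas hm, ← integral_mul_const]
    congr 1 with c
    ring
  rw [h1, integral_integral_swap]
  swap
  · exact hint.swap
  congr 1 with c
  rw [integral_const_mul]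
  congr 1
  rw [← FT2_swapSch g, FT2_eq_integral_partialFT, FT2_eq_integral_partialFT, mul_comm (∫ y : ℝ, _),
    ← integral_prod_mul]
  congr 1 with u
  rw [show -(u.1 * (ζ.1 - c.1)) = u.1 * c.1 + -(u.1 * ζ.1) by ring,
    show -(u.2 * (ζ.2 - c.2)) = u.2 * c.2 + -(u.2 * ζ.2) by ring, neg_add, e2π_add, e2π_add,
    e2π_add, e2π_add]
  ring

/-- The symbol `(1 + 4π²t²)^{s/2}` of the one-dimensional operator `(I - Δ)^{s/2}`. -/
def besselWeight₁ (s t : ℝ) : ℝ := (1 + 4 * Real.pi ^ 2 * t ^ 2) ^ (s / 2)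

lemma besselWeight₁_pos (s t : ℝ) : 0 < besselWeight₁ s t := by
  unfold besselWeight₁
  positivity

lemma one_le_besselWeight₁ {s : ℝ} (hs : 0 ≤ s) (t : ℝ) : 1 ≤ besselWeight₁ s t :=
  Real.one_le_rpow (by nlinarith [mul_nonneg (sq_nonneg Real.pi) (sq_nonneg t)]) (by positivity)

@[fun_prop] lemma continuous_besselWeight₁ (s : ℝ) : Continuous (besselWeight₁ s) :=
  Continuous.rpow_const (by fun_prop) fun t => .inl (by positivity)

@[fun_prop] lemma continuous_besselWeight (s : ℝ) : Continuous (besselWeight s) :=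
  Continuous.rpow_const (by fun_prop) fun t => .inl (by positivity)

/-- Peetre's inequality. -/
lemma besselWeight₁_add_le {s : ℝ} (hs : 0 ≤ s) (ξ η : ℝ × ℝ) :
    besselWeight₁ s (ξ.1 + η.1) ≤ 2 ^ (s / 2) * (besselWeight s ξ * besselWeight s η) := by
  unfold besselWeight₁ besselWeight
  rw [← Real.mul_rpow (by positivity) (by positivity), ← Real.mul_rpow (by positivity)
    (by positivity)]
  refine Real.rpow_le_rpow (by positivity) ?_ (by positivity)
  have hπ : 0 ≤ 4 * Real.pi ^ 2 := by positivity
  generalize 4 * Real.pi ^ 2 = c at hπ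
  have h1 : (ξ.1 + η.1) ^ 2 ≤ 2 * (ξ.1 ^ 2 + ξ.2 ^ 2) + 2 * (η.1 ^ 2 + η.2 ^ 2) := by
    nlinarith [sq_nonneg (ξ.1 - η.1), sq_nonneg ξ.2, sq_nonneg η.2]
  have h2 : 0 ≤ c * (ξ.1 ^ 2 + ξ.2 ^ 2) * (c * (η.1 ^ 2 + η.2 ^ 2)) := by positivity
  nlinarith [mul_le_mul_of_nonneg_left h1 hπ]

lemma nuSymb_mul_FT2_bessel (m : ℝ × ℝ → ℂ) (s : ℝ) (g : Sch) (w : (ℝ × ℝ) × (ℝ × ℝ)) :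
    nuSymb m s w * FT2 (bessel s g) w.2 =
      m (w.1.1, w.2.2) * besselWeight₁ s (w.1.1 + w.2.1) * FT2 g w.2 := by
  rw [FT2_bessel, nuSymb, besselWeight, Real.div_rpow (by positivity) (by positivity),
    besselWeight₁]
  have h : 0 < (1 + 4 * Real.pi ^ 2 * (w.2.1 ^ 2 + w.2.2 ^ 2)) ^ (s / 2) := by positivity
  generalize (1 + 4 * Real.pi ^ 2 * (w.2.1 ^ 2 + w.2.2 ^ 2)) ^ (s / 2) = B at h
  have hB : (B : ℂ) ≠ 0 := by exact_mod_cast h.ne'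
  push_cast
  field_simp

/-- The operator `T_ν` is obtained from `T_μ` by applying `(I - Δ_x)^{s/2}` to the result and
`(I - Δ)^{-s/2}` to the second function. -/
theorem Tmu_nuSymb_bessel_of_integrable {m : ℝ × ℝ → ℂ} {s : ℝ} (hs : 0 ≤ s) (hmeas : Measurable m)
    (hm : Integrable fun z => ‖m z‖ * (dec z.1 * dec z.2)) (f g : Sch) :
    Tmu (nuSymb m s) f (bessel s g) = JsX s (Tmu (muSymb m) f g) := by
  ext z
  obtain ⟨K, hK⟩ := exists_norm_FT2_mul_FT2_le (bessel s f) (bessel s g)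
  set F : (ℝ × ℝ) × (ℝ × ℝ) → ℂ := fun v => m v.1 * (besselWeight₁ s (v.1.1 + v.2.1) *
      e2π (z.1 * (v.1.1 + v.2.1) + z.2 * (v.2.2 + v.1.2)) *
      (FT2 f (v.1.1, v.2.2) * FT2 g (v.2.1, v.1.2))) with hF
  have hint : Integrable F := by
    refine integrable_symbol_mul hmeas hm (K := 2 ^ (s / 2) * K) (by fun_prop) (fun v => ?_)
    rw [norm_mul, norm_mul_e2π, Complex.norm_real, Real.norm_of_nonneg (besselWeight₁_pos _ _).le]
    calc _ ≤ 2 ^ (s / 2) * (besselWeight s (v.1.1, v.2.2) * besselWeight s (v.2.1, v.1.2)) *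
          ‖FT2 f (v.1.1, v.2.2) * FT2 g (v.2.1, v.1.2)‖ := by
          gcongr
          exact besselWeight₁_add_le hs (v.1.1, v.2.2) (v.2.1, v.1.2)
      _ = 2 ^ (s / 2) * ‖FT2 (bessel s f) (v.1.1, v.2.2) * FT2 (bessel s g) (v.2.1, v.1.2)‖ := by
          simp only [FT2_bessel, norm_mul, Complex.norm_real,
            Real.norm_of_nonneg (besselWeight_pos _ _).le]
          ring
      _ ≤ _ := by
          rw [mul_assoc]
          gcongr
          exact hK v
  have h1 : Tmu (nuSymb m s) f (bessel s g) z = ∫ v, F v := by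
    rw [← integral_exch, Tmu]
    congr 1 with w
    simp only [exch_apply, hF]
    linear_combination (e2π (z.1 * (w.1.1 + w.2.1) + z.2 * (w.1.2 + w.2.2)) * FT2 f w.1) *
      nuSymb_mul_FT2_bessel m s g w
  have h2 : JsX s (Tmu (muSymb m) f g) z = ∫ ζ : ℝ × ℝ, ∫ c : ℝ × ℝ, F (c, ζ - c) := by
    rw [JsX]
    congr 1 with ζ
    rw [FT2_Tmu_muSymb hmeas hm, ← integral_const_mul, ← integral_mul_const]
    congr 1 with c
    simp only [hF, besselWeight₁, Prod.fst_sub, Prod.snd_sub, add_sub_cancel, sub_add_cancel]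
    ring
  have h3 : Integrable (fun v : (ℝ × ℝ) × (ℝ × ℝ) => F (v.1, v.2 - v.1)) :=
    (measurePreserving_prod_sub volume volume).integrable_comp_of_integrable hint
  rw [h1, h2, integral_integral_swap]
  swap
  · exact h3.swap
  rw [Measure.volume_eq_prod, integral_prod _ hint]
  congr 1 with c
  rw [integral_sub_right_eq_self (fun d => F (c, d)) c]

lemma integral_comp_add_smul {E : Type*} [NormedAddCommGroup E] [NormedSpace ℝ E]
    [FiniteDimensional ℝ E] [MeasureSpace E] [BorelSpace E] [(volume : Measure E).IsAddHaarMeasure]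
    (F : E → ℂ) (c : E) {δ : ℝ} (hδ : 0 < δ) :
    ∫ ζ, F ζ = ((δ ^ Module.finrank ℝ E : ℝ) : ℂ) * ∫ w, F (c + δ • w) := by
  rw [Measure.integral_comp_smul volume (fun x => F (c + x)) δ, integral_add_left_eq_self F c,
    abs_of_pos (by positivity), Complex.real_smul, Complex.ofReal_inv, mul_inv_cancel_left₀]
  exact_mod_cast (pow_pos hδ _).ne'

/-- A smooth bump function that equals `1` on the ball of radius `δ` around `c` and vanishes
outside of the ball of radius `2δ`. -/
def bump (c : ℝ × ℝ) {δ : ℝ} (hδ : 0 < δ) : ContDiffBump c := ⟨δ, 2 * δ, hδ, by linarith⟩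

/-- The smooth bump function `bump c hδ` as a Schwartz function. -/
def bumpSch (c : ℝ × ℝ) {δ : ℝ} (hδ : 0 < δ) : Sch :=
  HasCompactSupport.toSchwartzMap (f := fun x => ((bump c hδ x : ℝ) : ℂ))
    ((bump c hδ).hasCompactSupport.comp_left Complex.ofReal_zero)
    (Complex.ofRealCLM.contDiff.comp (bump c hδ).contDiff)

lemma bumpSch_apply (c : ℝ × ℝ) {δ : ℝ} (hδ : 0 < δ) (x : ℝ × ℝ) :
    bumpSch c hδ x = ((bump c hδ x : ℝ) : ℂ) := rfl

lemma bumpSch_add_smul (c : ℝ × ℝ) {δ : ℝ} (hδ : 0 < δ) (w : ℝ × ℝ) :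
    bumpSch c hδ (c + δ • w) = bumpSch 0 one_pos w := by
  simp [bumpSch_apply, ContDiffBump.apply, bump, hδ.ne']

lemma mem_ball_of_bumpSch_ne_zero {c : ℝ × ℝ} {δ : ℝ} {hδ : 0 < δ} {x : ℝ × ℝ}
    (hx : bumpSch c hδ x ≠ 0) : x ∈ Metric.ball c (2 * δ) := by
  rw [bumpSch_apply, Complex.ofReal_ne_zero, ← Function.mem_support, ContDiffBump.support_eq] at hx
  exact hx

lemma norm_bumpSch_le_one (c : ℝ × ℝ) {δ : ℝ} (hδ : 0 < δ) (x : ℝ × ℝ) :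
    ‖bumpSch c hδ x‖ ≤ 1 := by
  rw [bumpSch_apply, Complex.norm_real, Real.norm_of_nonneg (bump c hδ).nonneg]
  exact (bump c hδ).le_one

/-- A Schwartz function whose Fourier transform is a bump function around `c`. -/
def wavePacket (c : ℝ × ℝ) {δ : ℝ} (hδ : 0 < δ) : Sch := schIFT (bumpSch c hδ)

lemma FT2_wavePacket (c : ℝ × ℝ) {δ : ℝ} (hδ : 0 < δ) :
    FT2 (wavePacket c hδ) = bumpSch c hδ := by
  ext ζ
  rw [wavePacket, FT2_schIFT]

lemma wavePacket_apply (c : ℝ × ℝ) {δ : ℝ} (hδ : 0 < δ) (x : ℝ × ℝ) :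
    wavePacket c hδ x =
      ((δ ^ 2 : ℝ) : ℂ) * e2π (x.1 * c.1 + x.2 * c.2) * wavePacket 0 one_pos (δ • x) := by
  rw [wavePacket, wavePacket, schIFT_apply, schIFT_apply, integral_comp_add_smul _ c hδ, mul_assoc,
    Module.finrank_prod, Module.finrank_self]
  congr 1
  rw [← integral_const_mul]
  refine integral_congr_ae (.of_forall fun w => ?_)
  dsimp only
  rw [bumpSch_add_smul, mul_left_comm, ← e2π_add]
  congr 2
  simp
  ring

instance isAddHaarMeasure_volume_prod_prod :
    (volume : Measure ((ℝ × ℝ) × (ℝ × ℝ))).IsAddHaarMeasure :=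
  inferInstanceAs ((volume : Measure (ℝ × ℝ)).prod volume).IsAddHaarMeasure

lemma Tmu_wavePacket (μ : (ℝ × ℝ) × (ℝ × ℝ) → ℂ) (w₀ : (ℝ × ℝ) × (ℝ × ℝ)) {δ : ℝ} (hδ : 0 < δ)
    (x : ℝ × ℝ) :
    Tmu μ (wavePacket w₀.1 hδ) (wavePacket w₀.2 hδ) x =
      ((δ ^ 4 : ℝ) : ℂ) * e2π (x.1 * (w₀.1.1 + w₀.2.1) + x.2 * (w₀.1.2 + w₀.2.2)) *
        Tmu (fun w => μ (w₀ + δ • w)) (wavePacket 0 one_pos) (wavePacket 0 one_pos) (δ • x) := by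
  simp only [Tmu, FT2_wavePacket]
  rw [integral_comp_add_smul _ w₀ hδ, mul_assoc]
  simp only [Module.finrank_prod, Module.finrank_self]
  congr 1
  rw [← integral_const_mul]
  refine integral_congr_ae (.of_forall fun w => ?_)
  dsimp only
  simp only [Prod.fst_add, Prod.snd_add, Prod.smul_fst, Prod.smul_snd, bumpSch_add_smul,
    smul_eq_mul]
  rw [show x.1 * (w₀.1.1 + δ * w.1.1 + (w₀.2.1 + δ * w.2.1)) +
      x.2 * (w₀.1.2 + δ * w.1.2 + (w₀.2.2 + δ * w.2.2)) =
    (x.1 * (w₀.1.1 + w₀.2.1) + x.2 * (w₀.1.2 + w₀.2.2)) +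
    (δ * x.1 * (w.1.1 + w.2.1) + δ * x.2 * (w.1.2 + w.2.2)) by ring, e2π_add]
  ring

lemma LpNorm_comp_smul {p : ℝ} (hp : 0 < p) {δ : ℝ} (hδ : 0 < δ) (G : ℝ × ℝ → ℂ) :
    LpNorm p (fun x => G (δ • x)) = ENNReal.ofReal (δ ^ (-2 / p)) * LpNorm p G := by
  have hemb : MeasurableEmbedding (δ • · : ℝ × ℝ → ℝ × ℝ) :=
    (Homeomorph.smulOfNeZero δ hδ.ne').measurableEmbedding
  rw [LpNorm, LpNorm, show (fun x => G (δ • x)) = G ∘ (δ • ·) from rfl,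
    ← hemb.eLpNorm_map_measure, Measure.map_addHaar_smul _ hδ.ne',
    eLpNorm_smul_measure_of_ne_zero (by simp [hδ.ne']), smul_eq_mul, abs_of_pos (by positivity),
    one_div, ENNReal.toReal_inv, ENNReal.toReal_ofReal hp.le,
    ENNReal.ofReal_rpow_of_pos (by positivity)]
  congr 2
  rw [Module.finrank_prod, Module.finrank_self, ← Real.rpow_natCast, ← Real.rpow_neg hδ.le,
    ← Real.rpow_mul hδ.le]
  norm_num [div_eq_mul_inv]

lemma LpNorm_dilate {p : ℝ} (hp : 0 < p) {δ : ℝ} (hδ : 0 < δ) (G : ℝ × ℝ → ℂ) (n : ℕ)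
    (φ : ℝ × ℝ → ℝ) :
    LpNorm p (fun x => ((δ ^ n : ℝ) : ℂ) * e2π (φ x) * G (δ • x)) =
      ENNReal.ofReal (δ ^ (n - 2 / p)) * LpNorm p G := by
  have h : LpNorm p (fun x => ((δ ^ n : ℝ) : ℂ) * e2π (φ x) * G (δ • x)) =
      LpNorm p (((δ ^ n : ℝ) : ℂ) • fun x => G (δ • x)) :=
    eLpNorm_congr_norm_ae (.of_forall fun x => by simp)
  rw [h, LpNorm, eLpNorm_const_smul, ← LpNorm, LpNorm_comp_smul hp hδ, ← mul_assoc,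
    ← ofReal_norm, Complex.norm_real, Real.norm_of_nonneg (by positivity),
    ← ENNReal.ofReal_mul (by positivity), sub_eq_add_neg, Real.rpow_add hδ, Real.rpow_natCast,
    neg_div]

lemma LpNorm_Tmu_translate_le {p q r : ℝ} (hp : 0 < p) (hq : 0 < q) (hr : 0 < r)
    (hpqr : 1 / p + 1 / q = 1 / r) {μ : (ℝ × ℝ) × (ℝ × ℝ) → ℂ} {w₀ : (ℝ × ℝ) × (ℝ × ℝ)}
    {δ : ℝ} (hδ : 0 < δ) {C : ℝ≥0∞}
    (h : LpNorm r (Tmu μ (wavePacket w₀.1 hδ) (wavePacket w₀.2 hδ)) ≤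
      C * LpNorm p (wavePacket w₀.1 hδ) * LpNorm q (wavePacket w₀.2 hδ)) :
    LpNorm r (Tmu (fun w => μ (w₀ + δ • w)) (wavePacket 0 one_pos) (wavePacket 0 one_pos)) ≤
      C * LpNorm p (wavePacket 0 one_pos) * LpNorm q (wavePacket 0 one_pos) := by
  have hT : Tmu μ (wavePacket w₀.1 hδ) (wavePacket w₀.2 hδ) = _ :=
    funext fun x => Tmu_wavePacket μ w₀ hδ x
  have h₁ : ⇑(wavePacket w₀.1 hδ) = _ := funext fun x => wavePacket_apply w₀.1 hδ x
  have h₂ : ⇑(wavePacket w₀.2 hδ) = _ := funext fun x => wavePacket_apply w₀.2 hδ x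
  rw [hT, h₁, h₂, LpNorm_dilate hr hδ, LpNorm_dilate hp hδ, LpNorm_dilate hq hδ] at h
  have hpow : δ ^ (((4 : ℕ) : ℝ) - 2 / r) = δ ^ (((2 : ℕ) : ℝ) - 2 / p) *
      δ ^ (((2 : ℕ) : ℝ) - 2 / q) := by
    rw [← Real.rpow_add hδ]
    congr 1
    push_cast
    linear_combination 2 * hpqr
  rw [hpow, ENNReal.ofReal_mul (by positivity)] at h
  set A := ENNReal.ofReal (δ ^ (((2 : ℕ) : ℝ) - 2 / p)) with hA
  set B := ENNReal.ofReal (δ ^ (((2 : ℕ) : ℝ) - 2 / q)) with hB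
  have hA0 : A ≠ 0 := by
    rw [hA, ENNReal.ofReal_ne_zero_iff]
    positivity
  have hB0 : B ≠ 0 := by
    rw [hB, ENNReal.ofReal_ne_zero_iff]
    positivity
  rw [← ENNReal.mul_le_mul_iff_right (mul_ne_zero hA0 hB0)
    (ENNReal.mul_ne_top ENNReal.ofReal_ne_top ENNReal.ofReal_ne_top)]
  refine h.trans (le_of_eq ?_)
  ring

lemma setLIntegral_closedBall_comp_add_smul (F : ℝ × ℝ → ℝ≥0∞) (z : ℝ × ℝ) {δ : ℝ} (hδ : 0 < δ)
    (R : ℝ) :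
    ∫⁻ c in Metric.closedBall 0 R, F (z + δ • c) =
      ENNReal.ofReal |(δ ^ Module.finrank ℝ (ℝ × ℝ))⁻¹| *
        ∫⁻ y in Metric.closedBall z (δ * R), F y := by
  have hemb : MeasurableEmbedding (δ • · : ℝ × ℝ → ℝ × ℝ) :=
    (Homeomorph.smulOfNeZero δ hδ.ne').measurableEmbedding
  have h1 : (Metric.closedBall 0 R : Set (ℝ × ℝ)) =
      (δ • ·) ⁻¹' Metric.closedBall 0 (δ * R) := by
    ext c
    simp [norm_smul, abs_of_pos hδ, hδ]
  have h2 : (Metric.closedBall 0 (δ * R) : Set (ℝ × ℝ)) =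
      (z + ·) ⁻¹' Metric.closedBall z (δ * R) := by
    ext c
    simp
  rw [h1, ← hemb.lintegral_map (fun y => F (z + y)), ← hemb.restrict_map,
    Measure.map_addHaar_smul _ hδ.ne',
    Measure.restrict_smul, lintegral_smul_measure, h2,
    (measurePreserving_add_left volume z).setLIntegral_comp_preimage_emb
      (measurableEmbedding_addLeft z)]
  rfl

/-- Almost every point is a Lebesgue point. -/
lemma ae_tendsto_setLIntegral_enorm_sub {m : ℝ × ℝ → ℂ} (hm : LocallyIntegrable m) {δ : ℕ → ℝ}
    (hδ : ∀ n, 0 < δ n) (hlim : Tendsto δ atTop (𝓝 0)) {R : ℝ} (hR : 0 < R) :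
    ∀ᵐ z, Tendsto (fun n => ∫⁻ c in Metric.closedBall 0 R, ‖m (z + δ n • c) - m z‖ₑ) atTop
      (𝓝 0) := by
  filter_upwards [(IsUnifLocDoublingMeasure.vitaliFamily (volume : Measure (ℝ × ℝ))
    1).ae_tendsto_lintegral_enorm_sub_div hm] with z hz
  have hδ' : Tendsto (fun n => δ n * R) atTop (𝓝[>] 0) := by
    refine tendsto_nhdsWithin_iff.2 ⟨by simpa using hlim.mul_const R, .of_forall fun n => ?_⟩
    exact mul_pos (hδ n) hR
  have h1 := hz.comp (IsUnifLocDoublingMeasure.tendsto_closedBall_filterAt volume (K := 1)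
    (fun _ => z) _ hδ' (.of_forall fun n => by simpa using (mul_pos (hδ n) hR).le))
  have h2 := ENNReal.Tendsto.const_mul (a := volume (Metric.closedBall (0 : ℝ × ℝ) R)) h1
    (.inr measure_closedBall_lt_top.ne)
  rw [mul_zero] at h2
  refine h2.congr fun n => ?_
  have h3 := setLIntegral_closedBall_comp_add_smul (fun _ => 1) z (hδ n) R
  rw [setLIntegral_one, setLIntegral_one] at h3
  rw [setLIntegral_closedBall_comp_add_smul (fun y => ‖m y - m z‖ₑ) z (hδ n) R, h3,
    Function.comp_apply, mul_assoc, ENNReal.mul_div_cancel]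
  · exact (Metric.measure_closedBall_pos volume z (mul_pos (hδ n) hR)).ne'
  · exact measure_closedBall_lt_top.ne

/-- The ratio of the symbols `ν` and `μ`. -/
def nuWeight (s : ℝ) (w : (ℝ × ℝ) × (ℝ × ℝ)) : ℝ :=
  ((1 + 4 * Real.pi ^ 2 * (w.1.1 + w.2.1) ^ 2) /
    (1 + 4 * Real.pi ^ 2 * (w.2.1 ^ 2 + w.2.2 ^ 2))) ^ (s / 2)

lemma nuSymb_eq (m : ℝ × ℝ → ℂ) (s : ℝ) (w : (ℝ × ℝ) × (ℝ × ℝ)) :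
    nuSymb m s w = m (w.1.1, w.2.2) * (nuWeight s w : ℂ) := rfl

@[fun_prop] lemma continuous_nuWeight (s : ℝ) : Continuous (nuWeight s) := by
  refine Continuous.rpow_const ?_ fun w => .inl (by positivity)
  exact Continuous.div (by fun_prop) (by fun_prop) fun w => by positivity

lemma measurable_nuSymb {m : ℝ × ℝ → ℂ} (hm : Measurable m) (s : ℝ) : Measurable (nuSymb m s) := by
  refine Measurable.mul (hm.comp (by fun_prop)) ?_
  exact (Complex.continuous_ofReal.comp (continuous_nuWeight s)).measurable

lemma Tmu_const (κ : ℂ) (f g : Sch) (x : ℝ × ℝ) : Tmu (fun _ => κ) f g x = κ * (f x * g x) := by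
  conv_rhs => rw [← schIFT_schFT f, ← schIFT_schFT g, schIFT_apply, schIFT_apply,
    ← integral_prod_mul, ← integral_const_mul]
  rw [Tmu]
  refine integral_congr_ae (.of_forall fun w => ?_)
  simp only [schFT_apply]
  rw [show x.1 * (w.1.1 + w.2.1) + x.2 * (w.1.2 + w.2.2) =
    (x.1 * w.1.1 + x.2 * w.1.2) + (x.1 * w.2.1 + x.2 * w.2.2) by ring, e2π_add]
  ring

lemma setLIntegral_closedBall_fst_snd {H : ℝ × ℝ → ℝ≥0∞} (hH : Measurable H) (R : ℝ) :
    ∫⁻ w : (ℝ × ℝ) × (ℝ × ℝ) in Metric.closedBall 0 R, H (w.1.1, w.2.2) =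
      (∫⁻ c in Metric.closedBall 0 R, H c) * volume (Metric.closedBall (0 : ℝ × ℝ) R) := by
  have h1 : (Metric.closedBall 0 R : Set ((ℝ × ℝ) × (ℝ × ℝ))) =
      exch ⁻¹' (Metric.closedBall 0 R ×ˢ Metric.closedBall 0 R) := by
    ext w
    simp only [mem_closedBall_zero_iff, Set.mem_preimage, exch_apply, Set.mem_prod,
      Prod.norm_def, sup_le_iff]
    tauto
  have h2 := measurePreserving_exch.setLIntegral_comp_preimage_emb exch.measurableEmbedding
    (fun v => H v.1) (Metric.closedBall 0 R ×ˢ Metric.closedBall 0 R)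
  simp only [exch_apply] at h2
  rw [h1, h2, Measure.volume_eq_prod, ← Measure.prod_restrict, lintegral_prod]
  · simp [lintegral_mul_const _ hH]
  · fun_prop

lemma integrable_FT2_mul_FT2 (f g : Sch) :
    Integrable fun w : (ℝ × ℝ) × (ℝ × ℝ) => FT2 f w.1 * FT2 g w.2 := by
  rw [FT2_eq_schFT, FT2_eq_schFT]
  exact (schFT f).integrable.mul_prod (schFT g).integrable

lemma tendsto_setLIntegral_nuWeight_sub (s : ℝ) (w₀ : (ℝ × ℝ) × (ℝ × ℝ)) {δ : ℕ → ℝ}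
    (hδ : ∀ n, |δ n| ≤ 1) (hlim : Tendsto δ atTop (𝓝 0)) (R : ℝ) :
    Tendsto (fun n => ∫⁻ w in Metric.closedBall 0 R,
      ‖nuWeight s (w₀ + δ n • w) - nuWeight s w₀‖ₑ) atTop (𝓝 0) := by
  obtain ⟨K, hK⟩ := (isCompact_closedBall w₀ R).exists_bound_of_continuousOn
    (continuous_nuWeight s).continuousOn
  have : Tendsto (fun n => ∫⁻ w in Metric.closedBall 0 R,
      ‖nuWeight s (w₀ + δ n • w) - nuWeight s w₀‖ₑ) atTop
      (𝓝 (∫⁻ w in Metric.closedBall (0 : (ℝ × ℝ) × (ℝ × ℝ)) R, 0)) := by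
    refine tendsto_lintegral_of_dominated_convergence (fun _ => ENNReal.ofReal (K + K))
      (fun n => ?_) (fun n => ?_) ?_ (.of_forall fun w => ?_)
    · exact (by fun_prop : Continuous fun w : (ℝ × ℝ) × (ℝ × ℝ) =>
        nuWeight s (w₀ + δ n • w) - nuWeight s w₀).measurable.enorm
    · filter_upwards [ae_restrict_mem Metric.isClosed_closedBall.measurableSet] with w hw
      rw [mem_closedBall_zero_iff] at hw
      rw [← ofReal_norm]
      refine ENNReal.ofReal_le_ofReal ((norm_sub_le _ _).trans (add_le_add (hK _ ?_) (hK _ ?_)))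
      · rw [mem_closedBall_iff_norm, add_sub_cancel_left, norm_smul, Real.norm_eq_abs]
        nlinarith [hδ n, norm_nonneg w]
      · exact Metric.mem_closedBall_self ((norm_nonneg w).trans hw)
    · rw [setLIntegral_const]
      exact ENNReal.mul_ne_top ENNReal.ofReal_ne_top measure_closedBall_lt_top.ne
    · have h1 : Tendsto (fun n => w₀ + δ n • w) atTop (𝓝 w₀) := by
        simpa using tendsto_const_nhds.add (hlim.smul_const w)
      have h2 := (((continuous_nuWeight s).tendsto w₀).comp h1).sub_const (nuWeight s w₀)
      simpa using h2.enorm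
  simpa using this

lemma tendsto_Tmu_wavePacket {m : ℝ × ℝ → ℂ} (hm : Measurable m) (s : ℝ)
    (w₀ : (ℝ × ℝ) × (ℝ × ℝ)) {δ : ℕ → ℝ} (hδ : ∀ n, |δ n| ≤ 1) (hlim : Tendsto δ atTop (𝓝 0))
    (hleb : Tendsto (fun n => ∫⁻ c in Metric.closedBall 0 2,
      ‖m ((w₀.1.1, w₀.2.2) + δ n • c) - m (w₀.1.1, w₀.2.2)‖ₑ) atTop (𝓝 0)) (x : ℝ × ℝ) :
    Tendsto (fun n => Tmu (fun w => nuSymb m s (w₀ + δ n • w)) (wavePacket 0 one_pos)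
      (wavePacket 0 one_pos) x) atTop
      (𝓝 (nuSymb m s w₀ * (wavePacket 0 one_pos x * wavePacket 0 one_pos x))) := by
  set Φ : Sch := wavePacket 0 one_pos with hΦ
  set z₀ : ℝ × ℝ := (w₀.1.1, w₀.2.2) with hz₀
  rw [← Tmu_const]
  have hmb : Measurable fun w : (ℝ × ℝ) × (ℝ × ℝ) =>
      e2π (x.1 * (w.1.1 + w.2.1) + x.2 * (w.1.2 + w.2.2)) * FT2 Φ w.1 * FT2 Φ w.2 :=
    Continuous.measurable (by fun_prop)
  have hmn (n : ℕ) : Measurable fun w => nuSymb m s (w₀ + δ n • w) :=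
    (measurable_nuSymb hm s).comp (by fun_prop)
  have hf : Integrable fun w : (ℝ × ℝ) × (ℝ × ℝ) => nuSymb m s w₀ *
      e2π (x.1 * (w.1.1 + w.2.1) + x.2 * (w.1.2 + w.2.2)) * FT2 Φ w.1 * FT2 Φ w.2 := by
    have := (integrable_mul_e2π (integrable_FT2_mul_FT2 Φ Φ)
      (φ := fun w => x.1 * (w.1.1 + w.2.1) + x.2 * (w.1.2 + w.2.2)) (by fun_prop)).const_mul
      (nuSymb m s w₀)
    refine this.congr (.of_forall fun w => ?_)
    dsimp only
    ring
  have hmF (n : ℕ) : Measurable fun w : (ℝ × ℝ) × (ℝ × ℝ) => nuSymb m s (w₀ + δ n • w) *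
      e2π (x.1 * (w.1.1 + w.2.1) + x.2 * (w.1.2 + w.2.2)) * FT2 Φ w.1 * FT2 Φ w.2 := by
    convert (hmn n).mul hmb using 1
    ext w
    simp only [Pi.mul_apply, mul_assoc]
  obtain ⟨K, hK⟩ := (isCompact_closedBall w₀ 2).exists_bound_of_continuousOn
    (continuous_nuWeight s).continuousOn
  have hbound (n : ℕ) : ∫⁻ w : (ℝ × ℝ) × (ℝ × ℝ), ‖nuSymb m s (w₀ + δ n • w) *
        e2π (x.1 * (w.1.1 + w.2.1) + x.2 * (w.1.2 + w.2.2)) * FT2 Φ w.1 * FT2 Φ w.2 -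
        nuSymb m s w₀ * e2π (x.1 * (w.1.1 + w.2.1) + x.2 * (w.1.2 + w.2.2)) *
          FT2 Φ w.1 * FT2 Φ w.2‖ₑ ≤
      ENNReal.ofReal K * ((∫⁻ c in Metric.closedBall 0 2, ‖m (z₀ + δ n • c) - m z₀‖ₑ) *
        volume (Metric.closedBall (0 : ℝ × ℝ) 2)) +
      ‖m z₀‖ₑ * ∫⁻ w in Metric.closedBall 0 2,
        ‖nuWeight s (w₀ + δ n • w) - nuWeight s w₀‖ₑ := by
    have hH : Measurable fun c => ‖m (z₀ + δ n • c) - m z₀‖ₑ :=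
      ((hm.comp (by fun_prop)).sub_const _).enorm
    have hH' : Measurable fun w : (ℝ × ℝ) × (ℝ × ℝ) =>
        ‖m (z₀ + δ n • (w.1.1, w.2.2)) - m z₀‖ₑ := hH.comp (by fun_prop)
    rw [← setLIntegral_closedBall_fst_snd hH, ← lintegral_const_mul _ hH',
      ← lintegral_const_mul' _ _ enorm_ne_top, ← lintegral_add_left (hH'.const_mul _),
      ← lintegral_indicator Metric.isClosed_closedBall.measurableSet]
    refine lintegral_mono fun w => ?_
    by_cases hw : w ∈ Metric.closedBall 0 2
    · rw [Set.indicator_of_mem hw, ← sub_mul, ← sub_mul, ← sub_mul, enorm_mul, enorm_mul, enorm_mul]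
      have h1 (v : ℝ × ℝ) : ‖FT2 Φ v‖ₑ ≤ 1 := by
        rw [hΦ, FT2_wavePacket, ← ofReal_norm, ENNReal.ofReal_le_one]
        exact norm_bumpSch_le_one _ _ _
      have h2 (t : ℝ) : ‖e2π t‖ₑ = 1 := by
        rw [← ofReal_norm, norm_e2π, ENNReal.ofReal_one]
      rw [h2, mul_one]
      have h3 : nuSymb m s (w₀ + δ n • w) - nuSymb m s w₀ =
          (m (z₀ + δ n • (w.1.1, w.2.2)) - m z₀) * (nuWeight s (w₀ + δ n • w) : ℂ) +
          m z₀ * ((nuWeight s (w₀ + δ n • w) - nuWeight s w₀ : ℝ) : ℂ) := by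
        simp only [nuSymb_eq, hz₀, Prod.fst_add, Prod.snd_add, Prod.smul_fst, Prod.smul_snd,
          Prod.mk_add_mk, Prod.smul_mk]
        push_cast
        ring
      have h4 : ‖(nuWeight s (w₀ + δ n • w) : ℂ)‖ₑ ≤ ENNReal.ofReal K := by
        rw [← ofReal_norm, Complex.norm_real]
        refine ENNReal.ofReal_le_ofReal (hK _ ?_)
        rw [mem_closedBall_zero_iff] at hw
        rw [mem_closedBall_iff_norm, add_sub_cancel_left, norm_smul, Real.norm_eq_abs]
        nlinarith [hδ n, norm_nonneg w]
      have h5 : ‖((nuWeight s (w₀ + δ n • w) - nuWeight s w₀ : ℝ) : ℂ)‖ₑ =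
          ‖nuWeight s (w₀ + δ n • w) - nuWeight s w₀‖ₑ := by
        rw [← ofReal_norm, ← ofReal_norm, Complex.norm_real]
      calc _ ≤ ‖nuSymb m s (w₀ + δ n • w) - nuSymb m s w₀‖ₑ * 1 * 1 := by
            gcongr
            exacts [h1 _, h1 _]
        _ ≤ _ := by
            rw [mul_one, mul_one, h3]
            refine (enorm_add_le _ _).trans ?_
            rw [enorm_mul, enorm_mul, h5, mul_comm ‖m _ - m _‖ₑ]
            gcongr
    · have hzero : FT2 Φ w.1 * FT2 Φ w.2 = 0 := by
        by_contra h0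
        refine hw ?_
        rw [hΦ, FT2_wavePacket] at h0
        have h1 := mem_ball_of_bumpSch_ne_zero (left_ne_zero_of_mul h0)
        have h2 := mem_ball_of_bumpSch_ne_zero (right_ne_zero_of_mul h0)
        rw [mul_one, mem_ball_zero_iff] at h1 h2
        rw [mem_closedBall_zero_iff, Prod.norm_def]
        exact sup_le h1.le h2.le
      rw [mul_assoc _ (FT2 Φ w.1), mul_assoc _ (FT2 Φ w.1), hzero]
      simp
  have hL : Tendsto (fun n => ∫⁻ w : (ℝ × ℝ) × (ℝ × ℝ), ‖nuSymb m s (w₀ + δ n • w) *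
        e2π (x.1 * (w.1.1 + w.2.1) + x.2 * (w.1.2 + w.2.2)) * FT2 Φ w.1 * FT2 Φ w.2 -
        nuSymb m s w₀ * e2π (x.1 * (w.1.1 + w.2.1) + x.2 * (w.1.2 + w.2.2)) *
          FT2 Φ w.1 * FT2 Φ w.2‖ₑ) atTop (𝓝 0) := by
    refine tendsto_of_tendsto_of_tendsto_of_le_of_le tendsto_const_nhds ?_ (fun n => zero_le)
      hbound
    have h1 := ENNReal.Tendsto.const_mul (a := ENNReal.ofReal K)
      (ENNReal.Tendsto.mul_const (b := volume (Metric.closedBall (0 : ℝ × ℝ) 2)) hleb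
      (.inr measure_closedBall_lt_top.ne)) (.inr ENNReal.ofReal_ne_top)
    have h2 := ENNReal.Tendsto.const_mul (a := ‖m z₀‖ₑ)
      (tendsto_setLIntegral_nuWeight_sub s w₀ hδ hlim 2) (.inr enorm_ne_top)
    simpa using h1.add h2
  refine tendsto_integral_of_L1 _ hf.1 ?_ hL
  filter_upwards [hL.eventually (gt_mem_nhds ENNReal.zero_lt_top)] with n hn
  have h1 : Integrable (fun w : (ℝ × ℝ) × (ℝ × ℝ) => nuSymb m s (w₀ + δ n • w) *
        e2π (x.1 * (w.1.1 + w.2.1) + x.2 * (w.1.2 + w.2.2)) * FT2 Φ w.1 * FT2 Φ w.2 -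
        nuSymb m s w₀ * e2π (x.1 * (w.1.1 + w.2.1) + x.2 * (w.1.2 + w.2.2)) *
          FT2 Φ w.1 * FT2 Φ w.2) := ⟨(hmF n).aestronglyMeasurable.sub hf.1, hn⟩
  exact (h1.add hf).congr (.of_forall fun w => by simp)

lemma exists_le_nuWeight {s : ℝ} (hs : 0 ≤ s) (z : ℝ × ℝ) :
    ∃ w : (ℝ × ℝ) × (ℝ × ℝ), (w.1.1, w.2.2) = z ∧ 2⁻¹ ^ (s / 2) ≤ nuWeight s w := by
  obtain ⟨c, hc, hc'⟩ : ∃ c : ℝ, c ^ 2 = z.2 ^ 2 ∧ 0 ≤ z.1 * c := by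
    rcases le_total 0 z.1 with h | h
    · exact ⟨|z.2|, sq_abs _, mul_nonneg h (abs_nonneg _)⟩
    · exact ⟨-|z.2|, by rw [neg_sq, sq_abs],
        mul_nonneg_of_nonpos_of_nonpos h (neg_nonpos.2 (abs_nonneg _))⟩
  refine ⟨((z.1, 0), (c, z.2)), rfl, Real.rpow_le_rpow (by positivity) ?_ (by positivity)⟩
  dsimp only
  rw [le_div_iff₀ (by positivity), ← hc]
  have h1 : c ^ 2 ≤ (z.1 + c) ^ 2 := by nlinarith [sq_nonneg z.1]
  nlinarith [mul_le_mul_of_nonneg_left h1 (by positivity : 0 ≤ 4 * Real.pi ^ 2)]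

lemma aestronglyMeasurable_Tmu {μ : (ℝ × ℝ) × (ℝ × ℝ) → ℂ} (hμ : Measurable μ) (f g : Sch) :
    AEStronglyMeasurable (Tmu μ f g) := by
  have h : Measurable fun t : (ℝ × ℝ) × ((ℝ × ℝ) × (ℝ × ℝ)) => μ t.2 *
      e2π (t.1.1 * (t.2.1.1 + t.2.2.1) + t.1.2 * (t.2.1.2 + t.2.2.2)) * FT2 f t.2.1 *
        FT2 g t.2.2 := by
    refine ((((hμ.comp measurable_snd).mul ?_).mul ?_).mul ?_)
    all_goals exact Continuous.measurable (by fun_prop)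
  exact h.stronglyMeasurable.integral_prod_right'.aestronglyMeasurable

lemma wavePacket_zero_ne_zero : wavePacket 0 one_pos 0 ≠ 0 := by
  rw [wavePacket, schIFT_apply]
  have h : ∫ ζ : ℝ × ℝ, bumpSch 0 one_pos ζ * e2π ((0 : ℝ × ℝ).1 * ζ.1 + (0 : ℝ × ℝ).2 * ζ.2) =
      ((∫ ζ : ℝ × ℝ, bump 0 one_pos ζ : ℝ) : ℂ) := by
    rw [← integral_complex_ofReal]
    simp [bumpSch_apply]
  rw [h, Complex.ofReal_ne_zero]
  exact (bump 0 one_pos).integral_pos.ne'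

lemma LpNorm_ne_top {p : ℝ} (f : Sch) : LpNorm p f ≠ ∞ := (f.memLp _ _).eLpNorm_ne_top

lemma LpNorm_wavePacket_sq_ne_zero {r : ℝ} (hr : 0 < r) :
    LpNorm r (fun x => wavePacket 0 one_pos x * wavePacket 0 one_pos x) ≠ 0 := by
  have hc : Continuous fun x : ℝ × ℝ => wavePacket 0 one_pos x * wavePacket 0 one_pos x := by
    fun_prop
  rw [LpNorm, Ne, eLpNorm_eq_zero_iff hc.aestronglyMeasurable (by simpa using hr)]
  intro h
  have h1 := congrFun (hc.ae_eq_iff_eq volume continuous_const |>.1 h) 0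
  exact wavePacket_zero_ne_zero (mul_self_eq_zero.1 h1)

/-- If `T_ν` satisfies an `L^p × L^q → L^r` bound for pairs of functions with frequencies that only
involve the values of `m` on an open set `u`, then `m` is essentially bounded on `u`. -/
theorem exists_ae_norm_le {p q r s : ℝ} (hp : 0 < p) (hq : 0 < q) (hr : 0 < r)
    (hpqr : 1 / p + 1 / q = 1 / r) (hs : 0 ≤ s) (C : ℝ) :
    ∃ M : ℝ, ∀ (m : ℝ × ℝ → ℂ) (u : Set (ℝ × ℝ)), Measurable m → LocallyIntegrable m → IsOpen u →
      (∀ f g : Sch, (∀ ξ η, FT2 f ξ ≠ 0 → FT2 g η ≠ 0 → (ξ.1, η.2) ∈ u) →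
        LpNorm r (Tmu (nuSymb m s) f g) ≤ ENNReal.ofReal C * LpNorm p f * LpNorm q g) →
      ∀ᵐ z, z ∈ u → ‖m z‖ ≤ M := by
  set Φ : Sch := wavePacket 0 one_pos with hΦ
  set N := LpNorm r (fun x => Φ x * Φ x) with hN
  set D := ENNReal.ofReal C * LpNorm p Φ * LpNorm q Φ with hD
  have hN0 : N ≠ 0 := LpNorm_wavePacket_sq_ne_zero hr
  have hDtop : D ≠ ∞ :=
    ENNReal.mul_ne_top (ENNReal.mul_ne_top ENNReal.ofReal_ne_top (LpNorm_ne_top _))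
      (LpNorm_ne_top _)
  refine ⟨(D / N).toReal / 2⁻¹ ^ (s / 2), fun m u hm hloc hu H => ?_⟩
  set δ : ℕ → ℝ := fun n => 1 / ((n : ℝ) + 1) with hδ
  have hδ0 (n : ℕ) : 0 < δ n := Nat.one_div_pos_of_nat
  have hδ1 (n : ℕ) : |δ n| ≤ 1 := by
    rw [abs_of_pos (hδ0 n), hδ]
    exact div_le_one_of_le₀ (by simp) (by positivity)
  have hlim : Tendsto δ atTop (𝓝 0) := tendsto_one_div_add_atTop_nhds_zero_nat
  filter_upwards [ae_tendsto_setLIntegral_enorm_sub hloc hδ0 hlim two_pos] with z hz hzu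
  obtain ⟨w₀, hw₀, hW⟩ := exists_le_nuWeight hs z
  have hT := tendsto_Tmu_wavePacket hm s w₀ hδ1 hlim (by rwa [hw₀])
  rw [← hΦ] at hT
  obtain ⟨ε, hε, hball⟩ := Metric.isOpen_iff.1 hu z hzu
  have hev : ∀ᶠ n in atTop, LpNorm r (Tmu (fun w => nuSymb m s (w₀ + δ n • w)) Φ Φ) ≤ D := by
    filter_upwards [hlim.eventually (gt_mem_nhds (half_pos hε))] with n hn
    refine LpNorm_Tmu_translate_le hp hq hr hpqr (hδ0 n) (H _ _ fun ξ η hξ hη => hball ?_)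
    rw [FT2_wavePacket] at hξ hη
    have h1 := mem_ball_of_bumpSch_ne_zero hξ
    have h2 := mem_ball_of_bumpSch_ne_zero hη
    rw [Metric.mem_ball, Prod.dist_eq, max_lt_iff] at h1 h2 ⊢
    rw [← hw₀]
    exact ⟨by linarith [h1.1], by linarith [h2.2]⟩
  have hfatou : LpNorm r (fun x => nuSymb m s w₀ * (Φ x * Φ x)) ≤ D := by
    refine (Lp.eLpNorm_lim_le_liminf_eLpNorm (fun n => aestronglyMeasurable_Tmu
      ((measurable_nuSymb hm s).comp (by fun_prop)) Φ Φ) _ (.of_forall hT)).trans ?_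
    exact liminf_le_of_frequently_le' hev.frequently
  have h1 : ‖nuSymb m s w₀‖ₑ * N ≤ D := by
    rw [hN, LpNorm, ← eLpNorm_const_smul]
    exact hfatou
  have h2 : ‖nuSymb m s w₀‖ₑ ≤ D / N := by
    rw [ENNReal.le_div_iff_mul_le (.inl hN0) (.inr hDtop)]
    exact h1
  have h3 : ‖nuSymb m s w₀‖ ≤ (D / N).toReal := by
    rw [← toReal_enorm]
    exact ENNReal.toReal_mono (ENNReal.div_ne_top hDtop hN0) h2
  rw [nuSymb_eq, hw₀, norm_mul, Complex.norm_real, Real.norm_of_nonneg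
    (le_trans (by positivity) hW)] at h3
  rw [le_div_iff₀ (by positivity)]
  exact le_trans (by gcongr) h3

lemma Tmu_congr {μ μ' : (ℝ × ℝ) × (ℝ × ℝ) → ℂ} {f g : ℝ × ℝ → ℂ}
    (h : ∀ᵐ w : (ℝ × ℝ) × (ℝ × ℝ), FT2 f w.1 ≠ 0 → FT2 g w.2 ≠ 0 → μ w = μ' w) :
    Tmu μ f g = Tmu μ' f g := by
  ext z
  refine integral_congr_ae (h.mono fun w hw => ?_)
  by_cases hf : FT2 f w.1 = 0
  · simp [hf]
  by_cases hg : FT2 g w.2 = 0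
  · simp [hg]
  simp only [hw hf hg]

lemma Tmu_eq_zero {μ : (ℝ × ℝ) × (ℝ × ℝ) → ℂ} {f g : ℝ × ℝ → ℂ}
    (h : ¬ Integrable fun w => μ w * (FT2 f w.1 * FT2 g w.2)) : Tmu μ f g = 0 := by
  ext z
  refine integral_undef fun hi => h ?_
  have := integrable_mul_e2π hi
    (φ := fun w => -(z.1 * (w.1.1 + w.2.1) + z.2 * (w.1.2 + w.2.2))) (by fun_prop)
  refine this.congr (.of_forall fun w => ?_)
  have he : e2π (z.1 * (w.1.1 + w.2.1) + z.2 * (w.1.2 + w.2.2)) *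
      e2π (-(z.1 * (w.1.1 + w.2.1) + z.2 * (w.1.2 + w.2.2))) = 1 := by
    rw [← e2π_add, add_neg_cancel, e2π_zero]
  linear_combination (μ w * (FT2 f w.1 * FT2 g w.2)) * he

lemma JsX_zero (s : ℝ) : JsX s 0 = 0 := by
  ext x
  simp [JsX, FT2]

lemma FT2_bessel_ne_zero_iff {s : ℝ} {g : Sch} {η : ℝ × ℝ} :
    FT2 (bessel s g) η ≠ 0 ↔ FT2 g η ≠ 0 := by
  simp [FT2_bessel, (besselWeight_pos s η).ne']

lemma Tmu_nuSymb_bessel_of_ae_eq {m m₀ : ℝ × ℝ → ℂ} {s : ℝ} (hs : 0 ≤ s) (hmeas : Measurable m₀)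
    (hm₀ : Integrable fun z => ‖m₀ z‖ * (dec z.1 * dec z.2)) {f g : Sch}
    (h : ∀ᵐ w : (ℝ × ℝ) × (ℝ × ℝ), FT2 f w.1 ≠ 0 → FT2 g w.2 ≠ 0 →
      m (w.1.1, w.2.2) = m₀ (w.1.1, w.2.2)) :
    Tmu (nuSymb m s) f (bessel s g) = JsX s (Tmu (muSymb m) f g) := by
  rw [Tmu_congr (μ := muSymb m) (μ' := muSymb m₀) h, ← Tmu_nuSymb_bessel_of_integrable hs hmeas hm₀]
  refine Tmu_congr (h.mono fun w hw hf hg => ?_)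
  rw [nuSymb, nuSymb, hw hf (FT2_bessel_ne_zero_iff.1 hg)]

lemma integrable_norm_mul_dec {m : ℝ × ℝ → ℂ} (hm : Integrable m) :
    Integrable fun z => ‖m z‖ * (dec z.1 * dec z.2) := by
  refine hm.norm.mono' (hm.1.norm.mul (by fun_prop)) (.of_forall fun z => ?_)
  have h (t : ℝ) : dec t ≤ 1 := inv_le_one_of_one_le₀ (by nlinarith)
  have := dec_pos z.1
  have := dec_pos z.2
  rw [Real.norm_of_nonneg (by positivity)]
  exact mul_le_of_le_one_right (norm_nonneg _) (mul_le_one₀ (h _) (by positivity) (h _))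

lemma integrable_norm_mul_dec_of_le {m : ℝ × ℝ → ℂ} (hm : Measurable m) {M : ℝ}
    (hM : ∀ z, ‖m z‖ ≤ M) : Integrable fun z => ‖m z‖ * (dec z.1 * dec z.2) := by
  refine (integrable_dec_prod.const_mul M).mono' (by fun_prop) (.of_forall fun z => ?_)
  have := dec_pos z.1
  have := dec_pos z.2
  rw [Real.norm_of_nonneg (by positivity)]
  gcongr
  exact hM z

lemma ae_norm_le_of_forall_isOpen {m : ℝ × ℝ → ℂ} {M : ℝ}
    (H : ∀ u, IsOpen u → IntegrableOn m u → ∀ᵐ z, z ∈ u → ‖m z‖ ≤ M) :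
    ∀ᵐ z, IntegrableAtFilter m (𝓝 z) → ‖m z‖ ≤ M := by
  refine measure_null_of_locally_null _ fun z hz => ?_
  obtain ⟨t, ht, hi⟩ := (Classical.not_imp.1 hz).1
  obtain ⟨u, hut, hu, hzu⟩ := mem_nhds_iff.1 ht
  refine ⟨_, inter_mem_nhdsWithin _ (hu.mem_nhds hzu),
    measure_mono_null (fun y hy => ?_) (H u hu (hi.mono_set hut))⟩
  exact Classical.not_imp.2 ⟨hy.2, (Classical.not_imp.1 hy.1).2⟩

/-- A function is integrable near `x` if its product with a function on a product space that does
not vanish at `(x, y)` is integrable. -/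
lemma integrableAtFilter_of_integrable_mul {m : ℝ × ℝ → ℂ} (hm : Measurable m)
    {K : (ℝ × ℝ) × (ℝ × ℝ) → ℂ} (hK : Continuous K) {v : (ℝ × ℝ) × (ℝ × ℝ)} (hv : K v ≠ 0)
    (hi : Integrable fun v => m v.1 * K v) : IntegrableAtFilter m (𝓝 v.1) := by
  have hc : 0 < ‖K v‖ / 2 := by positivity
  have hnhds : ∀ᶠ w in 𝓝 v.1 ×ˢ 𝓝 v.2, ‖K v‖ / 2 < ‖K w‖ := by
    rw [← nhds_prod_eq]
    exact hK.norm.continuousAt.eventually (lt_mem_nhds (half_lt_self (norm_pos_iff.2 hv)))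
  obtain ⟨s, hs, t, ht, hst⟩ := mem_prod_iff.1 hnhds
  obtain ⟨s', hs's, hs'o, hvs'⟩ := mem_nhds_iff.1 hs
  obtain ⟨t', ht't, ht'o, hvt'⟩ := mem_nhds_iff.1 ht
  refine ⟨s', hs'o.mem_nhds hvs', ?_⟩
  have h1 : IntegrableOn (fun v : (ℝ × ℝ) × (ℝ × ℝ) => m v.1) (s' ×ˢ t') := by
    refine ((hi.norm.const_mul (‖K v‖ / 2)⁻¹).integrableOn).mono'
      (hm.comp measurable_fst).aestronglyMeasurable ?_
    filter_upwards [ae_restrict_mem (hs'o.measurableSet.prod ht'o.measurableSet)] with w hw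
    have hw' : ‖K v‖ / 2 < ‖K w‖ := hst (Set.prod_mono hs's ht't hw)
    rw [norm_mul, ← div_eq_inv_mul, le_div_iff₀ hc]
    gcongr
  rw [IntegrableOn, Measure.volume_eq_prod, ← Measure.prod_restrict] at h1
  refine h1.of_comp_fst ?_
  rw [Ne, Measure.restrict_eq_zero]
  exact (ht'o.measure_pos volume ⟨_, hvt'⟩).ne'

/-- The intertwining identity, for symbols that are bounded near the points of local
integrability. -/
theorem Tmu_nuSymb_bessel {m : ℝ × ℝ → ℂ} {s : ℝ} (hs : 0 ≤ s) (hmeas : Measurable m) {M : ℝ}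
    (hM : ∀ᵐ z, IntegrableAtFilter m (𝓝 z) → ‖m z‖ ≤ M) (f g : Sch) :
    Tmu (nuSymb m s) f (bessel s g) = JsX s (Tmu (muSymb m) f g) := by
  by_cases hi : Integrable fun w => muSymb m w * (FT2 f w.1 * FT2 g w.2)
  · have hi' : Integrable fun v : (ℝ × ℝ) × (ℝ × ℝ) =>
        m v.1 * (FT2 f (v.1.1, v.2.2) * FT2 g (v.2.1, v.1.2)) :=
      measurePreserving_exch.integrable_comp_of_integrable hi
    have hset : MeasurableSet {z | ‖m z‖ ≤ M} := measurableSet_le hmeas.norm measurable_const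
    refine Tmu_nuSymb_bessel_of_ae_eq hs (m₀ := {z | ‖m z‖ ≤ M}.indicator m)
      (hmeas.indicator hset) (integrable_norm_mul_dec_of_le (hmeas.indicator hset) (M := |M|)
        fun z => ?_) ?_
    · by_cases hz : ‖m z‖ ≤ M
      · rw [Set.indicator_of_mem (by exact hz)]
        exact hz.trans (le_abs_self M)
      · rw [Set.indicator_of_notMem (by exact hz), norm_zero]
        exact abs_nonneg M
    · have hproj : Measure.QuasiMeasurePreserving
          fun w : (ℝ × ℝ) × (ℝ × ℝ) => (w.1.1, w.2.2) :=
        Measure.quasiMeasurePreserving_fst.comp measurePreserving_exch.quasiMeasurePreserving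
      filter_upwards [hproj.ae hM] with w hw hf hg
      have hz : (w.1.1, w.2.2) ∈ {z | ‖m z‖ ≤ M} := hw ?_
      · exact (Set.indicator_of_mem hz m).symm
      exact integrableAtFilter_of_integrable_mul hmeas (v := exch w)
        (K := fun v => FT2 f (v.1.1, v.2.2) * FT2 g (v.2.1, v.1.2)) (by fun_prop)
        (mul_ne_zero hf hg) hi'
  · rw [Tmu_eq_zero hi, JsX_zero,
      Tmu_eq_zero fun hν => hi (hν.norm.mono' ?_ (.of_forall fun w => ?_))]
    · exact ((hmeas.comp (by fun_prop)).mul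
        (Continuous.measurable (by fun_prop))).aestronglyMeasurable
    · have h := congrArg norm (nuSymb_mul_FT2_bessel m s g w)
      rw [norm_mul, norm_mul, norm_mul, Complex.norm_real,
        Real.norm_of_nonneg (besselWeight₁_pos _ _).le] at h
      have h1 := one_le_besselWeight₁ hs (w.1.1 + w.2.1)
      rw [muSymb, norm_mul, norm_mul, norm_mul, norm_mul]
      calc ‖m (w.1.1, w.2.2)‖ * (‖FT2 f w.1‖ * ‖FT2 g w.2‖)
          = ‖m (w.1.1, w.2.2)‖ * 1 * ‖FT2 g w.2‖ * ‖FT2 f w.1‖ := by ring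
        _ ≤ ‖m (w.1.1, w.2.2)‖ * besselWeight₁ s (w.1.1 + w.2.1) * ‖FT2 g w.2‖ * ‖FT2 f w.1‖ := by
          gcongr
        _ = _ := by
          rw [← h]
          ring

lemma nuConsts_eq_of_Tmu_eq {m : ℝ × ℝ → ℂ} {s : ℝ} (p q r : ℝ)
    (h : ∀ f g : Sch, Tmu (nuSymb m s) f (bessel s g) = JsX s (Tmu (muSymb m) f g)) :
    nuConsts m s p q r = muConsts m s p q r := by
  ext C
  refine and_congr_right fun _ => forall_congr' fun f => ⟨fun H g => ?_, fun H g => ?_⟩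
  · rw [WNorm_eq, WxNorm, ← h]
    exact H (bessel s g)
  · have := H (bessel (-s) g)
    rwa [WNorm_eq, WxNorm, ← h, bessel_bessel_neg] at this

lemma exists_ae_norm_le_of_forall_isOpen {p q r s : ℝ} (hp : 0 < p) (hq : 0 < q) (hr : 0 < r)
    (hpqr : 1 / p + 1 / q = 1 / r) (hs : 0 ≤ s) {m : ℝ × ℝ → ℂ} (hmeas : Measurable m) (C : ℝ)
    (H : ∀ u, IsOpen u → IntegrableOn m u → ∀ f g : Sch,
      (∀ ξ η, FT2 f ξ ≠ 0 → FT2 g η ≠ 0 → (ξ.1, η.2) ∈ u) →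
        LpNorm r (Tmu (nuSymb m s) f g) ≤ ENNReal.ofReal C * LpNorm p f * LpNorm q g) :
    ∃ M : ℝ, ∀ᵐ z, IntegrableAtFilter m (𝓝 z) → ‖m z‖ ≤ M := by
  obtain ⟨M, hM⟩ := exists_ae_norm_le hp hq hr hpqr hs C
  refine ⟨M, ae_norm_le_of_forall_isOpen fun u hu hi => ?_⟩
  have hloc : LocallyIntegrable (u.indicator m) :=
    ((integrable_indicator_iff hu.measurableSet).2 hi).locallyIntegrable
  have hbound := hM (u.indicator m) u (hmeas.indicator hu.measurableSet) hloc hu fun f g hfg => by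
    rw [Tmu_congr (μ' := nuSymb m s) (.of_forall fun w hf hg => ?_)]
    · exact H u hu hi f g hfg
    · rw [nuSymb, nuSymb, Set.indicator_of_mem (hfg _ _ hf hg)]
  filter_upwards [hbound] with z hz hzu
  simpa [hzu] using hz hzu

lemma nuConsts_eq_muConsts {p q r s : ℝ} (hp : 0 < p) (hq : 0 < q) (hr : 0 < r)
    (hpqr : 1 / p + 1 / q = 1 / r) (hs : 0 ≤ s) {m : ℝ × ℝ → ℂ} (hmeas : Measurable m) :
    nuConsts m s p q r = muConsts m s p q r := by
  suffices h : ∀ C, C ∈ nuConsts m s p q r ∨ C ∈ muConsts m s p q r →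
      nuConsts m s p q r = muConsts m s p q r by
    by_contra hne
    exact hne (Set.ext fun C => ⟨fun hC => absurd (h C (.inl hC)) hne,
      fun hC => absurd (h C (.inr hC)) hne⟩)
  intro C hC
  suffices H : ∀ u, IsOpen u → IntegrableOn m u → ∀ f g : Sch,
      (∀ ξ η, FT2 f ξ ≠ 0 → FT2 g η ≠ 0 → (ξ.1, η.2) ∈ u) →
        LpNorm r (Tmu (nuSymb m s) f g) ≤ ENNReal.ofReal C * LpNorm p f * LpNorm q g by
    obtain ⟨M, hM⟩ := exists_ae_norm_le_of_forall_isOpen hp hq hr hpqr hs hmeas C H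
    exact nuConsts_eq_of_Tmu_eq p q r (Tmu_nuSymb_bessel hs hmeas hM)
  intro u hu hi f g hfg
  rcases hC with hC | hC
  · exact hC.2 f g
  · have h := hC.2 f (bessel (-s) g)
    rwa [WNorm_eq, WxNorm, ← Tmu_nuSymb_bessel_of_ae_eq hs (hmeas.indicator hu.measurableSet)
      (integrable_norm_mul_dec ((integrable_indicator_iff hu.measurableSet).2 hi)),
      bessel_bessel_neg] at h
    refine .of_forall fun w hf hg => ?_
    rw [Set.indicator_of_mem (hfg _ _ hf (FT2_bessel_ne_zero_iff.1 hg))]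

/-- `T_μ : L^p × W^{s,q} → L^r_y(W^{s,r}_x)` is bounded iff
`T_ν : L^p × L^q → L^r` is bounded, with equal operator norms. -/
theorem statement8 (p q r s : ℝ) (hp : 1 < p) (hq : 1 < q) (hr : 1 < r)
    (hpqr : 1 / p + 1 / q = 1 / r) (hs : 0 < s)
    (m : ℝ × ℝ → ℂ) (hmeas : Measurable m) :
    ((nuConsts m s p q r).Nonempty ↔ (muConsts m s p q r).Nonempty) ∧
      sInf (nuConsts m s p q r) = sInf (muConsts m s p q r) := by
  rw [nuConsts_eq_muConsts (by linarith) (by linarith) (by linarith) hpqr hs.le hmeas]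
  exact ⟨Iff.rfl, rfl⟩
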